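/- For the n-sphere Sⁿ, the reduced topological complexity is TC(Sⁿ) = 1 if n is odd and TC(Sⁿ) = 2 if n is even, and in both cases it equals the zero-divisor cup-length: nil ker ∪_{Sⁿ} = TC(Sⁿ). -/

import Mathlib

open unitInterval Set ContinuousMap TensorProduct

/-- `X × X` admits a cover by `n+1` open sets, on each of which the free path
fibration `ev₀,₁ : Xᴵ → X × X` admits a continuous section. -/
def TCCover (X : Type*) [TopologicalSpace X] (n : ℕ) : Prop :=
  ∃ U : Fin (n + 1) → Set (X × X), (∀ i, IsOpen (U i)) ∧ (⋃ i, U i) = Set.univ ∧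
    ∀ i, ∃ s : C(U i, C(I, X)),
      ∀ p : U i, (s p) 0 = (p : X × X).1 ∧ (s p) 1 = (p : X × X).2

/-- Farber's (reduced) topological complexity, as an extended natural number. -/
noncomputable def TopComplexity (X : Type*) [TopologicalSpace X] : ℕ∞ :=
  sInf ((fun n : ℕ => (n : ℕ∞)) '' {n : ℕ | TCCover X n})

/-- The `n`-sphere. -/
abbrev Sph (n : ℕ) : Type :=
  Metric.sphere (0 : EuclideanSpace ℝ (Fin (n + 1))) 1

/-- Every product of `m+1` elements of `K` vanishes. -/
def ProdVanish {R : Type*} [Ring R] (K : Set R) (m : ℕ) : Prop :=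
  ∀ l : List R, l.length = m + 1 → (∀ x ∈ l, x ∈ K) → l.prod = 0

/-- The nilpotency index of a set `K` in a ring: the least `m` such that every
product of `m+1` elements of `K` vanishes. -/
noncomputable def nilIndex {R : Type*} [Ring R] (K : Set R) : ℕ∞ :=
  sInf ((fun m : ℕ => (m : ℕ∞)) '' {m : ℕ | ProdVanish K m})

/-- The rational cohomology ring of `Sⁿ × Sⁿ` for `n` odd: the exterior algebra
`Λ(a, b)` on two generators of odd degree `n` (Koszul-signed Künneth). The cup
product `H^*(Sⁿ × Sⁿ; ℚ) → H^*(Sⁿ; ℚ)` sends both generators to the generator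
`ε` of `H^*(Sⁿ; ℚ) = ℚ[ε]/(ε²)`. -/
noncomputable def cupOdd : ExteriorAlgebra ℚ (ℚ × ℚ) →ₐ[ℚ] DualNumber ℚ :=
  ExteriorAlgebra.lift ℚ
    ⟨(LinearMap.fst ℚ ℚ ℚ + LinearMap.snd ℚ ℚ ℚ).smulRight (DualNumber.eps),
      fun m => by
        simp only [LinearMap.smulRight_apply]
        rw [smul_mul_smul_comm, DualNumber.eps_mul_eps, smul_zero]⟩

/-- The rational cohomology ring of `Sⁿ × Sⁿ` for `n` even:
`ℚ[a]/(a²) ⊗ ℚ[b]/(b²)` by the Künneth theorem, with the cup product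
`H^*(Sⁿ × Sⁿ; ℚ) → H^*(Sⁿ; ℚ)` given by multiplication. -/
noncomputable def cupEven : DualNumber ℚ ⊗[ℚ] DualNumber ℚ →ₐ[ℚ] DualNumber ℚ :=
  Algebra.TensorProduct.lmul' ℚ

section

open MeasureTheory
open scoped ContDiff Topology

section Determinant

variable {ι V : Type*} [Fintype ι] [DecidableEq ι] [NormedAddCommGroup V] [NormedSpace ℝ V]

/-- The determinant with respect to a basis, as a continuous alternating map. -/
noncomputable def basisDet (b : Module.Basis ι ℝ V) : V [⋀^ι]→L[ℝ] ℝ :=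
  { b.det with
    cont := by
      have : FiniteDimensional ℝ V := b.finiteDimensional_of_finite
      change Continuous fun v : ι → V => b.det v
      simp only [Module.Basis.det_apply]
      refine Continuous.matrix_det (continuous_matrix fun i j => ?_)
      exact ((b.coord i).continuous_of_finiteDimensional).comp (continuous_apply j) }

theorem basisDet_apply (b : Module.Basis ι ℝ V) (v : ι → V) : basisDet b v = b.det v := rfl

theorem basisDet_comp (b : Module.Basis ι ℝ V) (A : V →L[ℝ] V) :
    basisDet b (fun i => A (b i)) = A.det := by
  have := b.det_comp A.toLinearMap b
  rw [b.det_self, mul_one] at this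
  exact this

/-- Cramer's rule. -/
theorem sum_basisDet_update_smul (b : Module.Basis ι ℝ V) (v : ι → V) (w : V) :
    ∑ j, basisDet b (Function.update v j w) • v j = basisDet b v • w := by
  apply b.repr.injective
  ext k
  have h := congrFun (Matrix.mulVec_cramer (b.toMatrix v) (b.repr w)) k
  have h2 : ∀ j, basisDet b (Function.update v j w) =
      (b.toMatrix v).cramer (b.repr w) j := by
    intro j
    rw [Matrix.cramer_apply, basisDet_apply, Module.Basis.det_apply, b.toMatrix_update]
  simp only [h2, map_sum, map_smul, Finsupp.coe_finsetSum, Finset.sum_apply, Finsupp.smul_apply,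
    smul_eq_mul, basisDet_apply, Module.Basis.det_apply]
  simp only [Pi.smul_apply, smul_eq_mul] at h
  rw [← h, Matrix.mulVec, dotProduct]
  exact Finset.sum_congr rfl fun j _ => mul_comm _ _

/-- The algebraic identity behind the vanishing divergence of the cofactor matrix. -/
theorem sum_alternating_update_update_eq_zero (D : V [⋀^ι]→L[ℝ] ℝ) (v : ι → V) (w : V)
    (B : ι → ι → V) (hB : ∀ i j, B i j = B j i) :
    ∑ j, ∑ k, (if k = j then 0 else
      D (Function.update (Function.update v j w) k (B j k))) = 0 := by
  set T : ι → ι → ℝ := fun j k => if k = j then 0 else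
      D (Function.update (Function.update v j w) k (B j k)) with hT
  have hanti : ∀ j k, T j k = - T k j := by
    intro j k
    by_cases hjk : k = j
    · simp [hT, hjk]
    · have hjk' : j ≠ k := fun h => hjk h.symm
      simp only [hT, if_neg hjk, if_neg hjk']
      have := D.toAlternatingMap.map_swap
        (Function.update (Function.update v k w) j (B k j)) hjk'
      simp only [ContinuousAlternatingMap.coe_toAlternatingMap] at this
      rw [← this]
      congr 1
      ext i
      by_cases hi : i = k
      · subst hi; simp [hB]
      · by_cases hij : i = j
        · subst hij; simp [hi, hjk]
        · simp [Equiv.swap_apply_of_ne_of_ne hij hi, hi, hij]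
  change ∑ j, ∑ k, T j k = 0
  have h1 : ∑ j, ∑ k, T j k = - ∑ j, ∑ k, T j k := by
    conv_lhs => rw [Finset.sum_comm]
    rw [← Finset.sum_neg_distrib]
    refine Finset.sum_congr rfl fun j _ => ?_
    rw [← Finset.sum_neg_distrib]
    exact Finset.sum_congr rfl fun k _ => hanti k j
  linarith

end Determinant

section Divergence

variable {ι V : Type*} [Fintype ι] [DecidableEq ι] [NormedAddCommGroup V] [NormedSpace ℝ V]

theorem hasFDerivAt_alternating_update (b : Module.Basis ι ℝ V) (D : V [⋀^ι]→L[ℝ] ℝ)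
    {F G : V → V} (hF : ContDiff ℝ ∞ F) (hG : ContDiff ℝ ∞ G) (j : ι) (x : V) :
    HasFDerivAt (fun y => D (Function.update (fun i => fderiv ℝ F y (b i)) j (G y)))
      (∑ k, (D.1.toContinuousLinearMap
          (Function.update (fun i => fderiv ℝ F x (b i)) j (G x)) k) ∘L
        (Function.update (fun i => (fderiv ℝ (fderiv ℝ F) x).flip (b i)) j (fderiv ℝ G x) k)) x := by
  have h1 : ∀ k, HasFDerivAt
      (fun y => Function.update (fun i => fderiv ℝ F y (b i)) j (G y) k)
      (Function.update (fun i => (fderiv ℝ (fderiv ℝ F) x).flip (b i)) j (fderiv ℝ G x) k) x := by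
    intro k
    by_cases hk : k = j
    · subst hk
      simpa using (hG.differentiable (by simp) x).hasFDerivAt
    · simp only [Function.update_of_ne hk]
      have : DifferentiableAt ℝ (fderiv ℝ F) x :=
        (hF.fderiv_right (m := ∞) (by simp)).differentiable (by simp) x
      exact (this.hasFDerivAt.clm_apply (hasFDerivAt_const (b k) x)).congr_fderiv (by ext; simp)
  exact HasFDerivAt.multilinear_comp (f := D.1) h1

theorem sum_fderiv_alternating_update (b : Module.Basis ι ℝ V) (D : V [⋀^ι]→L[ℝ] ℝ)
    {F G : V → V} (hF : ContDiff ℝ ∞ F) (hG : ContDiff ℝ ∞ G) (x : V) :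
    ∑ j, fderiv ℝ (fun y => D (Function.update (fun i => fderiv ℝ F y (b i)) j (G y))) x (b j) =
      ∑ j, D (Function.update (fun i => fderiv ℝ F x (b i)) j (fderiv ℝ G x (b j))) := by
  set v : ι → V := fun i => fderiv ℝ F x (b i) with hv
  set B : ι → ι → V := fun j k => fderiv ℝ (fderiv ℝ F) x (b j) (b k) with hBdef
  have hB : ∀ i j, B i j = B j i := by
    intro i j
    have := hF.contDiffAt (x := x) |>.isSymmSndFDerivAt (by
      simp only [minSmoothness_of_isRCLikeNormedField]
      exact WithTop.coe_le_coe.2 (le_top (a := (2 : ℕ∞))))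
    exact this _ _
  rw [← add_zero (∑ j, D (Function.update v j (fderiv ℝ G x (b j)))),
    ← sum_alternating_update_update_eq_zero D v (G x) B hB, ← Finset.sum_add_distrib]
  refine Finset.sum_congr rfl fun j _ => ?_
  rw [(hasFDerivAt_alternating_update b D hF hG j x).fderiv, _root_.sum_apply]
  have h : D (Function.update v j (fderiv ℝ G x (b j))) =
      ∑ k, if k = j then D (Function.update v k (fderiv ℝ G x (b j))) else 0 := by simp
  rw [h, ← Finset.sum_add_distrib]
  refine Finset.sum_congr rfl fun k _ => ?_
  by_cases hk : k = j
  · subst hk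
    simp [ContinuousMultilinearMap.toContinuousLinearMap, v]
  · simp [ContinuousMultilinearMap.toContinuousLinearMap, hk, v, B]

theorem contDiff_alternating_update (b : Module.Basis ι ℝ V) (D : V [⋀^ι]→L[ℝ] ℝ)
    {F G : V → V} (hF : ContDiff ℝ ∞ F) (hG : ContDiff ℝ ∞ G) (j : ι) :
    ContDiff ℝ ∞ (fun y => D (Function.update (fun i => fderiv ℝ F y (b i)) j (G y))) := by
  refine D.1.contDiff.comp (contDiff_pi.2 fun k => ?_)
  by_cases hk : k = j
  · subst hk; simpa using hG
  · simp only [Function.update_of_ne hk]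
    exact (hF.fderiv_right (m := ∞) (by simp)).clm_apply contDiff_const

theorem divergence_cutoff (b : Module.Basis ι ℝ V) {χ ρ : V → ℝ} {F G : V → V}
    (hχ : ContDiff ℝ ∞ χ) (hρ : ContDiff ℝ ∞ ρ) (hF : ContDiff ℝ ∞ F) (hG : ContDiff ℝ ∞ G)
    (x : V) (hx : fderiv ℝ χ x = 0 ∨ ρ (F x) = 0) :
    ∑ j, fderiv ℝ (fun y => χ y * ρ (F y) *
        basisDet b (Function.update (fun i => fderiv ℝ F y (b i)) j (G y))) x (b j) =
      χ x * fderiv ℝ ρ (F x) (G x) * basisDet b (fun i => fderiv ℝ F x (b i)) +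
      χ x * ρ (F x) *
        ∑ j, basisDet b (Function.update (fun i => fderiv ℝ F x (b i)) j (fderiv ℝ G x (b j))) := by
  have hW := fun j => (contDiff_alternating_update b (basisDet b) hF hG j).differentiable
    (by simp) x |>.hasFDerivAt
  have h1 : HasFDerivAt (fun y => χ y * ρ (F y))
      (χ x • (fderiv ℝ ρ (F x) ∘L fderiv ℝ F x) + ρ (F x) • fderiv ℝ χ x) x :=
    (hχ.differentiable (by simp) x).hasFDerivAt.mul
      (((hρ.differentiable (by simp) (F x)).hasFDerivAt).comp x
        (hF.differentiable (by simp) x).hasFDerivAt)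
  have h2 : ρ (F x) • fderiv ℝ χ x = 0 := by
    rcases hx with h | h <;> simp [h]
  rw [h2, add_zero] at h1
  rw [← sum_fderiv_alternating_update b (basisDet b) hF hG x]
  have h3 : fderiv ℝ ρ (F x) (G x) * basisDet b (fun i => fderiv ℝ F x (b i)) =
      ∑ j, fderiv ℝ ρ (F x) (fderiv ℝ F x (b j)) *
        basisDet b (Function.update (fun i => fderiv ℝ F x (b i)) j (G x)) := by
    have := congrArg (fderiv ℝ ρ (F x))
      (sum_basisDet_update_smul b (fun i => fderiv ℝ F x (b i)) (G x))
    simp only [map_sum, map_smul, smul_eq_mul] at this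
    rw [mul_comm, ← this]
    exact Finset.sum_congr rfl fun j _ => mul_comm _ _
  rw [mul_assoc (χ x) (fderiv ℝ ρ (F x) (G x)), h3, Finset.mul_sum, Finset.mul_sum,
    ← Finset.sum_add_distrib]
  refine Finset.sum_congr rfl fun j _ => ?_
  have h4 : HasFDerivAt (fun y => χ y * ρ (F y) *
      basisDet b (Function.update (fun i => fderiv ℝ F y (b i)) j (G y))) _ x := h1.mul (hW j)
  rw [h4.fderiv]
  simp
  ring

end Divergence

section Integral

variable {V : Type*} [NormedAddCommGroup V] [NormedSpace ℝ V] [FiniteDimensional ℝ V]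
  [MeasurableSpace V] [BorelSpace V] (μ : Measure V) [μ.IsAddHaarMeasure]

/-- The degree integral `∫ χ · f^*(ρ dx)` of a map `f`, localized by a cutoff function `χ`. -/
noncomputable def degIntegral (χ ρ : V → ℝ) (f : V → V) : ℝ :=
  ∫ x, χ x * ρ (f x) * (fderiv ℝ f x).det ∂μ

theorem integral_fderiv_eq_zero {W : V → ℝ} (hW : ContDiff ℝ ∞ W) (hc : HasCompactSupport W)
    (v : V) : ∫ x, fderiv ℝ W x v ∂μ = 0 := by
  have hd : Continuous fun x => fderiv ℝ W x v :=
    (hW.continuous_fderiv (by simp)).clm_apply continuous_const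
  have := integral_mul_fderiv_eq_neg_fderiv_mul_of_integrable (μ := μ) (f := fun _ : V => (1 : ℝ))
    (g := W) (v := v) (by simp)
    (by simpa using hd.integrable_of_hasCompactSupport (hc.fderiv_apply ℝ v))
    (by simpa using hW.continuous.integrable_of_hasCompactSupport hc)
    (fun x _ => by fun_prop) (fun x _ => hW.differentiable (by simp) x)
  simpa using this

omit [FiniteDimensional ℝ V] in
/-- Differentiation under the integral sign for compactly supported smooth families. -/
theorem hasDerivAt_integral_of_contDiff {k : ℝ × V → ℝ} (hk : ContDiff ℝ ∞ k) {K : Set V}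
    (hK : IsCompact K) (hkK : ∀ t, ∀ x ∉ K, k (t, x) = 0) (t₀ : ℝ) :
    HasDerivAt (fun t => ∫ x, k (t, x) ∂μ) (∫ x, fderiv ℝ k (t₀, x) (1, 0) ∂μ) t₀ := by
  have hk' : Continuous fun p : ℝ × V => fderiv ℝ k p (1, 0) :=
    (hk.continuous_fderiv (by simp)).clm_apply continuous_const
  have hderiv : ∀ t x, HasDerivAt (fun s => k (s, x)) (fderiv ℝ k (t, x) (1, 0)) t := by
    intro t x
    have h1 : HasFDerivAt k (fderiv ℝ k (t, x)) (t, x) :=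
      (hk.differentiable (by simp) (t, x)).hasFDerivAt
    have h2 : HasDerivAt (fun s : ℝ => (s, x)) ((1 : ℝ), (0 : V)) t :=
      (hasDerivAt_id t).prodMk (hasDerivAt_const t x)
    exact h1.comp_hasDerivAt t h2
  have hzero : ∀ t, ∀ x ∉ K, fderiv ℝ k (t, x) (1, 0) = 0 := by
    intro t x hx
    have := (hderiv t x).deriv
    rw [← this]
    simp [hkK _ x hx]
  have hcs : ∀ g : V → ℝ, (∀ x ∉ K, g x = 0) → HasCompactSupport g :=
    fun g hg => HasCompactSupport.intro hK hg
  obtain ⟨C, hC⟩ := ((isCompact_closedBall t₀ 1).prod hK).exists_bound_of_continuousOn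
    hk'.continuousOn
  refine (hasDerivAt_integral_of_dominated_loc_of_deriv_le (μ := μ)
    (F' := fun t x => fderiv ℝ k (t, x) (1, 0)) (bound := K.indicator fun _ => C)
    (Metric.closedBall_mem_nhds t₀ one_pos)
    (Filter.Eventually.of_forall fun t =>
      (hk.continuous.comp (Continuous.prodMk_right t)).aestronglyMeasurable)
    ((hk.continuous.comp (Continuous.prodMk_right t₀)).integrable_of_hasCompactSupport
      (hcs _ (hkK t₀)))
    (hk'.comp (Continuous.prodMk_right t₀)).aestronglyMeasurable
    (Filter.Eventually.of_forall fun x t ht => ?_) ?_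
    (Filter.Eventually.of_forall fun x t _ => hderiv t x)).2
  · by_cases hx : x ∈ K
    · simpa [hx] using hC (t, x) ⟨ht, hx⟩
    · simp [hx, hzero t x hx]
  · exact (integrable_indicator_iff hK.measurableSet).2
      (integrableOn_const hK.measure_lt_top.ne)

theorem degIntegral_eq_of_line {χ ρ : V → ℝ} {f g : V → V}
    (hχ : ContDiff ℝ ∞ χ) (hχc : HasCompactSupport χ) (hρ : ContDiff ℝ ∞ ρ)
    (hf : ContDiff ℝ ∞ f) (hg : ContDiff ℝ ∞ g)
    (h : ∀ t ∈ Icc (0 : ℝ) 1, ∀ x, fderiv ℝ χ x = 0 ∨ ρ (f x + t • (g x - f x)) = 0) :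
    degIntegral μ χ ρ f = degIntegral μ χ ρ g := by
  let b := Module.finBasis ℝ V
  set G : V → V := fun x => g x - f x with hGdef
  have hG : ContDiff ℝ ∞ G := hg.sub hf
  set F : ℝ → V → V := fun t x => f x + t • G x with hFdef
  have hF : ∀ t, ContDiff ℝ ∞ (F t) := fun t => hf.add (contDiff_const.smul hG)
  have hFd : ∀ t x, fderiv ℝ (F t) x = fderiv ℝ f x + t • fderiv ℝ G x := by
    intro t x
    have h1 := (hf.differentiable (by simp) x).hasFDerivAt
    have h2 := (hG.differentiable (by simp) x).hasFDerivAt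
    exact (h1.add (h2.const_smul t)).fderiv
  set k : ℝ × V → ℝ := fun p => χ p.2 * ρ (f p.2 + p.1 • G p.2) *
    basisDet b (fun i => fderiv ℝ f p.2 (b i) + p.1 • fderiv ℝ G p.2 (b i)) with hkdef
  have hfd : ∀ {q : V → V}, ContDiff ℝ ∞ q → ∀ i, ContDiff ℝ ∞
      fun p : ℝ × V => fderiv ℝ q p.2 (b i) := fun hq i =>
    ((hq.fderiv_right (m := ∞) (by simp)).comp contDiff_snd).clm_apply contDiff_const
  have hk : ContDiff ℝ ∞ k := by
    refine ((hχ.comp contDiff_snd).mul (hρ.comp ?_)).mul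
      ((basisDet b).1.contDiff.comp (contDiff_pi.2 fun i => ?_))
    · exact (hf.comp contDiff_snd).add (contDiff_fst.smul (hG.comp contDiff_snd))
    · exact (hfd hf i).add (contDiff_fst.smul (hfd hG i))
  have hkint : ∀ t, ∫ x, k (t, x) ∂μ = degIntegral μ χ ρ (F t) := by
    intro t
    refine integral_congr_ae (Filter.Eventually.of_forall fun x => ?_)
    simp only [hkdef, ← basisDet_comp b, hFd]
    rfl
  have hderiv := hasDerivAt_integral_of_contDiff μ hk hχc
    (fun t x hx => by simp [hkdef, image_eq_zero_of_notMem_tsupport hx])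
  have hzero : ∀ t ∈ Icc (0 : ℝ) 1, ∫ x, fderiv ℝ k (t, x) (1, 0) ∂μ = 0 := by
    intro t ht
    set W : Fin (Module.finrank ℝ V) → V → ℝ := fun j y => χ y * ρ (F t y) *
        basisDet b (Function.update (fun i => fderiv ℝ (F t) y (b i)) j (G y)) with hW
    have hWs : ∀ j, ContDiff ℝ ∞ (W j) := fun j =>
      (hχ.mul (hρ.comp (hF t))).mul (contDiff_alternating_update b (basisDet b) (hF t) hG j)
    have hWc : ∀ j, HasCompactSupport (W j) := fun j => hχc.mul_right.mul_right
    have hpt : ∀ x, fderiv ℝ k (t, x) (1, 0) = ∑ j, fderiv ℝ (W j) x (b j) := by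
      intro x
      rw [divergence_cutoff b hχ hρ (hF t) hG x (h t ht x)]
      have h1 : HasFDerivAt k (fderiv ℝ k (t, x)) (t, x) :=
        (hk.differentiable (by simp) (t, x)).hasFDerivAt
      have h2 : HasDerivAt (fun s : ℝ => (s, x)) ((1 : ℝ), (0 : V)) t :=
        (hasDerivAt_id t).prodMk (hasDerivAt_const t x)
      have h3 := h1.comp_hasDerivAt t h2
      have hl : ∀ u w : V, HasDerivAt (fun s : ℝ => u + s • w) w t := by
        intro u w
        simpa using ((hasDerivAt_id t).smul_const w).const_add u
      have h4 : HasDerivAt (fun s : ℝ => ρ (f x + s • G x)) (fderiv ℝ ρ (F t x) (G x)) t :=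
        (hρ.differentiable (by simp) (F t x)).hasFDerivAt.comp_hasDerivAt t (hl (f x) (G x))
      have h5 : HasFDerivAt (fun s : ℝ => basisDet b
          (fun i => fderiv ℝ f x (b i) + s • fderiv ℝ G x (b i))) _ t :=
        HasFDerivAt.multilinear_comp (f := (basisDet b).1)
          (fun i => (hl (fderiv ℝ f x (b i)) (fderiv ℝ G x (b i))).hasFDerivAt)
      have h6 := (h4.const_mul (χ x)).mul h5.hasDerivAt
      have h7 := h3.unique h6
      rw [h7]
      simp only [hFd]
      simp [hFdef, ContinuousMultilinearMap.toContinuousLinearMap]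
    simp_rw [hpt]
    rw [integral_finsetSum]
    · exact Finset.sum_eq_zero fun j _ => integral_fderiv_eq_zero μ (hWs j) (hWc j) (b j)
    · intro j _
      exact (((hWs j).continuous_fderiv (by simp)).clm_apply
        continuous_const).integrable_of_hasCompactSupport ((hWc j).fderiv_apply ℝ (b j))
  have hconst := constant_of_has_deriv_right_zero (a := (0 : ℝ)) (b := 1)
    (f := fun t => ∫ x, k (t, x) ∂μ)
    (fun t _ => (hderiv t).continuousAt.continuousWithinAt)
    (fun t ht => by
      have := hderiv t
      rw [hzero t (Ico_subset_Icc_self ht)] at this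
      exact this.hasDerivWithinAt) 1 (by simp)
  simp only [hkint] at hconst
  have h0 : F 0 = f := by ext x; simp [hFdef]
  have h1 : F 1 = g := by ext x; simp [hFdef, hGdef]
  rw [h0, h1] at hconst
  exact hconst.symm

end Integral

section Degree

variable {V : Type*} [NormedAddCommGroup V] [NormedSpace ℝ V] [FiniteDimensional ℝ V]

theorem exists_contDiff_dist_lt {K : Set V} (hK : IsCompact K) {h : V → V}
    (hh : ContinuousOn h K) {ε : ℝ} (hε : 0 < ε) :
    ∃ f : V → V, ContDiff ℝ ∞ f ∧ ∀ x ∈ K, dist (f x) (h x) < ε := by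
  obtain ⟨g, hg⟩ := ContinuousMap.exists_restrict_eq hK.isClosed
    (⟨K.domRestrict h, hh.domRestrict⟩ : C(K, V))
  obtain ⟨f, hf, hfg, -⟩ := g.continuous.exists_contDiff_approx (ε := fun _ => ε) ⊤
    continuous_const (fun _ => hε)
  refine ⟨f, hf, fun x hx => ?_⟩
  have : g x = h x := DFunLike.congr_fun hg ⟨x, hx⟩
  exact this ▸ hfg x

omit [NormedSpace ℝ V] [FiniteDimensional ℝ V] in
theorem exists_pos_le_dist {X : Type*} [TopologicalSpace X] {S : Set X} (hS : IsCompact S)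
    {h : X → V} (hh : ContinuousOn h S) {p : V} (hp : ∀ x ∈ S, h x ≠ p) :
    ∃ δ > 0, ∀ x ∈ S, 2 * δ ≤ dist (h x) p := by
  rcases S.eq_empty_or_nonempty with rfl | hne
  · exact ⟨1, one_pos, by simp⟩
  obtain ⟨x, hx, hmin⟩ := hS.exists_isMinOn hne (f := fun x => dist (h x) p)
    (continuous_id.dist continuous_const |>.comp_continuousOn hh)
  refine ⟨dist (h x) p / 2, half_pos (dist_pos.2 (hp x hx)), fun y hy => ?_⟩
  have : dist (h x) p ≤ dist (h y) p := hmin hy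
  linarith

omit [FiniteDimensional ℝ V] in
theorem tsupport_fderiv_subset_of {χ : V → ℝ} {K : Set V} (hχK : tsupport χ ⊆ K) :
    tsupport (fderiv ℝ χ) ⊆ K := (tsupport_fderiv_subset ℝ).trans hχK

variable [MeasurableSpace V] [BorelSpace V] (μ : Measure V) [μ.IsAddHaarMeasure]

/-- The map `h`, localized by the cutoff function `χ`, has degree `d` over the point `p`;
the degree is computed from smooth maps that approximate `h` on `K`. -/
def HasDeg (K : Set V) (χ : V → ℝ) (p : V) (h : V → V) (d : ℝ) : Prop :=
  ∃ δ > 0, ∀ ρ : V → ℝ, ContDiff ℝ ∞ ρ → Function.support ρ ⊆ Metric.ball p δ →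
    ∀ f : V → V, ContDiff ℝ ∞ f → (∀ x ∈ K, dist (f x) (h x) < δ) →
      degIntegral μ χ ρ f = d * ∫ x, ρ x ∂μ

variable {K : Set V} {χ : V → ℝ} {p : V} {h : V → V} {d d' : ℝ} {μ}

theorem degIntegral_eq_of_near (hK : IsCompact K) (hχ : ContDiff ℝ ∞ χ) (hχK : tsupport χ ⊆ K)
    {δ : ℝ} (hp : ∀ x ∈ tsupport (fderiv ℝ χ), 2 * δ ≤ dist (h x) p)
    {ρ : V → ℝ} (hρ : ContDiff ℝ ∞ ρ) (hρp : Function.support ρ ⊆ Metric.ball p δ)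
    {f g : V → V} (hf : ContDiff ℝ ∞ f) (hg : ContDiff ℝ ∞ g)
    (hfh : ∀ x ∈ K, dist (f x) (h x) < δ) (hgh : ∀ x ∈ K, dist (g x) (h x) < δ) :
    degIntegral μ χ ρ f = degIntegral μ χ ρ g := by
  refine degIntegral_eq_of_line μ hχ (hK.of_isClosed_subset (isClosed_tsupport _) hχK) hρ hf hg
    fun t ht x => ?_
  by_cases hx : x ∈ tsupport (fderiv ℝ χ)
  · right
    have hxK := tsupport_fderiv_subset_of hχK hx
    have hmem : f x + t • (g x - f x) ∈ Metric.ball (h x) δ :=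
      (convex_ball (h x) δ).add_smul_sub_mem (hfh x hxK) (hgh x hxK) ht
    by_contra hne
    have h1 : f x + t • (g x - f x) ∈ Metric.ball p δ := hρp hne
    have h2 := hp x hx
    have h3 := dist_triangle_left (h x) p (f x + t • (g x - f x))
    rw [Metric.mem_ball] at h1 hmem
    linarith
  · exact Or.inl (image_eq_zero_of_notMem_tsupport hx)

theorem HasDeg.unique (hK : IsCompact K) (hh : ContinuousOn h K)
    (h1 : HasDeg μ K χ p h d) (h2 : HasDeg μ K χ p h d') : d = d' := by
  obtain ⟨δ, hδ, H⟩ := h1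
  obtain ⟨δ', hδ', H'⟩ := h2
  have hm : 0 < min δ δ' := lt_min hδ hδ'
  obtain ⟨f, hf, hfh⟩ := exists_contDiff_dist_lt hK hh hm
  let ρ : ContDiffBump p := ⟨min δ δ' / 2, min δ δ', half_pos hm, half_lt_self hm⟩
  have hρ : Function.support ρ = Metric.ball p (min δ δ') := ρ.support_eq
  have e1 := H ρ ρ.contDiff (hρ.subset.trans (Metric.ball_subset_ball (min_le_left _ _))) f hf
    fun x hx => (hfh x hx).trans_le (min_le_left _ _)
  have e2 := H' ρ ρ.contDiff (hρ.subset.trans (Metric.ball_subset_ball (min_le_right _ _))) f hf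
    fun x hx => (hfh x hx).trans_le (min_le_right _ _)
  exact mul_right_cancel₀ (ρ.integral_pos (μ := μ)).ne' (e1.symm.trans e2)

theorem HasDeg.homotopy (hK : IsCompact K) (hχ : ContDiff ℝ ∞ χ) (hχK : tsupport χ ⊆ K)
    {H : I × V → V} (hH : ContinuousOn H (univ ×ˢ K))
    (hp : ∀ t, ∀ x ∈ tsupport (fderiv ℝ χ), H (t, x) ≠ p)
    (h0 : HasDeg μ K χ p (fun x => H (0, x)) d) : HasDeg μ K χ p (fun x => H (1, x)) d := by
  obtain ⟨δ₀, hδ₀, h0⟩ := h0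
  have hS : IsCompact (tsupport (fderiv ℝ χ)) :=
    hK.of_isClosed_subset (isClosed_tsupport _) (tsupport_fderiv_subset_of hχK)
  obtain ⟨δ₁, hδ₁, hdist⟩ := exists_pos_le_dist (isCompact_univ.prod hS) (p := p)
    (hH.mono (Set.prod_mono_right (tsupport_fderiv_subset_of hχK))) (fun x hx => hp x.1 x.2 hx.2)
  set δ := min δ₀ δ₁ with hδdef
  have hδ : 0 < δ := lt_min hδ₀ hδ₁
  have hHt : ∀ t, ContinuousOn (fun x => H (t, x)) K := fun t =>
    hH.comp (by fun_prop) (fun x hx => ⟨trivial, hx⟩)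
  have hpt : ∀ t, ∀ x ∈ tsupport (fderiv ℝ χ), 2 * δ ≤ dist (H (t, x)) p := fun t x hx =>
    (mul_le_mul_of_nonneg_left (min_le_right _ _) zero_le_two).trans (hdist (t, x) ⟨trivial, hx⟩)
  let P : I → Prop := fun t => ∀ ρ : V → ℝ, ContDiff ℝ ∞ ρ →
    Function.support ρ ⊆ Metric.ball p δ → ∀ f : V → V, ContDiff ℝ ∞ f →
    (∀ x ∈ K, dist (f x) (H (t, x)) < δ) → degIntegral μ χ ρ f = d * ∫ x, ρ x ∂μ
  have key : ∀ t, ∀ g : V → V, ContDiff ℝ ∞ g → (∀ x ∈ K, dist (g x) (H (t, x)) < δ) →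
      (P t ↔ ∀ ρ : V → ℝ, ContDiff ℝ ∞ ρ → Function.support ρ ⊆ Metric.ball p δ →
        degIntegral μ χ ρ g = d * ∫ x, ρ x ∂μ) := by
    intro t g hg hgH
    refine ⟨fun hP ρ hρ hρp => hP ρ hρ hρp g hg hgH, fun hP ρ hρ hρp f hf hfH => ?_⟩
    rw [degIntegral_eq_of_near (h := fun x => H (t, x)) hK hχ hχK (hpt t) hρ hρp hf hg hfH hgH]
    exact hP ρ hρ hρp
  have hloc : IsLocallyConstant P := by
    rw [IsLocallyConstant.iff_eventually_eq]
    intro t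
    obtain ⟨g, hg, hgH⟩ := exists_contDiff_dist_lt hK (hHt t) (half_pos hδ)
    obtain ⟨v, hv, hvd⟩ := hK.mem_uniformity_of_prod (f := fun t x => H (t, x)) (s := univ) hH
      (mem_univ t) (Metric.dist_mem_uniformity (half_pos hδ))
    rw [nhdsWithin_univ] at hv
    filter_upwards [hv] with s hs
    refine propext ((key s g hg fun x hx => ?_).trans
      (key t g hg fun x hx => (hgH x hx).trans (half_lt_self hδ)).symm)
    have h1 : dist (H (s, x)) (H (t, x)) < δ / 2 := hvd s hs x hx
    have h2 := hgH x hx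
    have h3 := dist_triangle_right (g x) (H (s, x)) (H (t, x))
    linarith
  have hP0 : P 0 := fun ρ hρ hρp f hf hfH => h0 ρ hρ
    (hρp.trans (Metric.ball_subset_ball (min_le_left _ _))) f hf
    fun x hx => (hfH x hx).trans_le (min_le_left _ _)
  have hP1 : P 1 := by rwa [hloc.apply_eq_of_preconnectedSpace 1 0]
  exact ⟨δ, hδ, hP1⟩

omit [FiniteDimensional ℝ V] [BorelSpace V] [μ.IsAddHaarMeasure] in
theorem hasDeg_zero (hK : IsCompact K) (hχK : tsupport χ ⊆ K) (hh : ContinuousOn h K)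
    (hp : ∀ x ∈ tsupport χ, h x ≠ p) : HasDeg μ K χ p h 0 := by
  obtain ⟨δ, hδ, hdist⟩ := exists_pos_le_dist (hK.of_isClosed_subset (isClosed_tsupport _) hχK)
    (hh.mono hχK) hp
  refine ⟨δ, hδ, fun ρ _ hρp f _ hfh => ?_⟩
  rw [zero_mul]
  refine integral_eq_zero_of_ae (Filter.Eventually.of_forall fun x => ?_)
  by_cases hx : x ∈ tsupport χ
  · have : ρ (f x) = 0 := by
      by_contra hne
      have h1 : f x ∈ Metric.ball p δ := hρp hne
      have h2 := hdist x hx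
      have h3 := dist_triangle_left (h x) p (f x)
      have h4 := hfh x (hχK hx)
      rw [Metric.mem_ball] at h1
      linarith
    simp [this]
  · simp [image_eq_zero_of_notMem_tsupport hx]

omit [FiniteDimensional ℝ V] in
theorem HasDeg.sub {χ' : V → ℝ} (hK : IsCompact K) (hχ : ContDiff ℝ ∞ χ) (hχK : tsupport χ ⊆ K)
    (hχ' : ContDiff ℝ ∞ χ') (hχK' : tsupport χ' ⊆ K)
    (h1 : HasDeg μ K χ p h d) (h2 : HasDeg μ K χ' p h d') :
    HasDeg μ K (fun x => χ x - χ' x) p h (d - d') := by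
  obtain ⟨δ, hδ, H⟩ := h1
  obtain ⟨δ', hδ', H'⟩ := h2
  refine ⟨min δ δ', lt_min hδ hδ', fun ρ hρ hρp f hf hfh => ?_⟩
  have e1 := H ρ hρ (hρp.trans (Metric.ball_subset_ball (min_le_left _ _))) f hf
    fun x hx => (hfh x hx).trans_le (min_le_left _ _)
  have e2 := H' ρ hρ (hρp.trans (Metric.ball_subset_ball (min_le_right _ _))) f hf
    fun x hx => (hfh x hx).trans_le (min_le_right _ _)
  rw [sub_mul, ← e1, ← e2]
  have h_integrable : ∀ ψ : V → ℝ, ContDiff ℝ ∞ ψ → tsupport ψ ⊆ K →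
      Integrable (fun x => ψ x * ρ (f x) * (fderiv ℝ f x).det) μ := by
    intro ψ hψ hψK
    have hc : HasCompactSupport ψ := hK.of_isClosed_subset (isClosed_tsupport _) hψK
    refine Continuous.integrable_of_hasCompactSupport ?_ hc.mul_right.mul_right
    exact (hψ.continuous.mul (hρ.continuous.comp hf.continuous)).mul
      (ContinuousLinearMap.continuous_det.comp (hf.continuous_fderiv (by simp)))
  rw [degIntegral, degIntegral, degIntegral,
    ← integral_sub (h_integrable χ hχ hχK) (h_integrable χ' hχ' hχK')]
  congr 1 with x
  ring

theorem hasDeg_linear (hK : IsCompact K) (hχ : ContDiff ℝ ∞ χ) (hχK : tsupport χ ⊆ K)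
    (L : V →L[ℝ] V) (hL : L.det = 1) {q : V} (hq : L q = p) (hχq : ∀ᶠ x in 𝓝 q, χ x = 1) :
    HasDeg μ K χ p L 1 := by
  let e := L.toContinuousLinearEquivOfDetNeZero (by simp [hL])
  have he : ∀ x, e x = L x := fun x => rfl
  have hqS : q ∉ tsupport (fderiv ℝ χ) := by
    rw [notMem_tsupport_iff_eventuallyEq]
    filter_upwards [hχq.eventually_nhds] with x hx
    have : χ =ᶠ[𝓝 x] fun _ => 1 := hx
    rw [this.fderiv_eq]
    simp
  obtain ⟨δ₁, hδ₁, hdist⟩ := exists_pos_le_dist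
    (hK.of_isClosed_subset (isClosed_tsupport _) (tsupport_fderiv_subset_of hχK))
    (h := L) L.continuous.continuousOn (p := p) (fun x hx hxp =>
      hqS ((e.injective ((he x).trans (hxp.trans hq.symm)) : x = q) ▸ hx))
  have hnhds : e '' {x | χ x = 1} ∈ 𝓝 p := by
    rw [← hq]
    exact e.toHomeomorph.isOpenMap.image_mem_nhds hχq
  obtain ⟨δ₂, hδ₂, hball⟩ := Metric.mem_nhds_iff.1 hnhds
  refine ⟨min δ₁ δ₂, lt_min hδ₁ hδ₂, fun ρ hρ hρp f hf hfh => ?_⟩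
  rw [degIntegral_eq_of_near (h := L) hK hχ hχK
    (fun x hx => (mul_le_mul_of_nonneg_left (min_le_left _ _) zero_le_two).trans (hdist x hx))
    hρ hρp hf L.contDiff hfh (by simp [hδ₁, hδ₂]), one_mul]
  have hdet : LinearMap.det (L : V →ₗ[ℝ] V) = 1 := hL
  have hmap := Measure.map_linearMap_addHaar_eq_smul_addHaar μ (f := (L : V →ₗ[ℝ] V))
    (by simp [hdet])
  rw [hdet] at hmap
  simp only [inv_one, abs_one, ENNReal.ofReal_one, one_smul] at hmap
  calc degIntegral μ χ ρ L = ∫ x, ρ (L x) ∂μ := by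
        refine integral_congr_ae (Filter.Eventually.of_forall fun x => ?_)
        simp only [L.fderiv, hL, mul_one]
        by_cases hx : ρ (L x) = 0
        · simp [hx]
        · obtain ⟨y, hy, hyx⟩ := hball (Metric.ball_subset_ball (min_le_right _ _) (hρp hx))
          have : y = x := e.injective hyx
          rw [← this, show χ y = 1 from hy, one_mul]
    _ = ∫ x, ρ x ∂(Measure.map L μ) :=
        (integral_map L.continuous.aemeasurable hρ.continuous.aestronglyMeasurable).symm
    _ = ∫ x, ρ x ∂μ := by rw [show Measure.map L μ = μ from hmap]

end Degree

section SphereProduct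

variable {E : Type*} [NormedAddCommGroup E] [InnerProductSpace ℝ E]

local notation "𝕊" => Metric.sphere (0 : E) 1

/-- Radial projection to the unit sphere, with an arbitrary value `N` at the origin. -/
noncomputable def toSphere (N : 𝕊) (x : E) : 𝕊 :=
  open Classical in if h : x = 0 then N else ⟨‖x‖⁻¹ • x, by simp [norm_smul, h]⟩

theorem norm_smul_toSphere (N : 𝕊) (x : E) : ‖x‖ • (toSphere N x : E) = x := by
  by_cases h : x = 0
  · simp [h]
  · simp [toSphere, h, smul_smul]

theorem toSphere_of_norm_eq_one (N : 𝕊) {x : E} (h : ‖x‖ = 1) : (toSphere N x : E) = x := by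
  simpa [h] using norm_smul_toSphere N x

theorem continuousOn_toSphere (N : 𝕊) : ContinuousOn (toSphere N) {x | x ≠ 0} := by
  rw [Topology.IsInducing.subtypeVal.continuousOn_iff]
  refine ContinuousOn.congr (f := fun x : E => ‖x‖⁻¹ • x) ?_ fun x hx => ?_
  · exact (continuous_norm.continuousOn.inv₀ fun x hx => norm_ne_zero_iff.2 hx).smul
      continuousOn_id
  · simp [toSphere, show x ≠ 0 from hx]

/-- The radial extension of a self-map of `𝕊 × 𝕊` with components `a` and `b`. -/
noncomputable def radialExt (N : 𝕊) (a b : 𝕊 × 𝕊 → 𝕊) (z : E × E) : E × E :=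
  (‖z.1‖ • (a (toSphere N z.1, toSphere N z.2) : E),
    ‖z.2‖ • (b (toSphere N z.1, toSphere N z.2) : E))

theorem norm_radialExt (N : 𝕊) (a b : 𝕊 × 𝕊 → 𝕊) (z : E × E) :
    ‖(radialExt N a b z).1‖ = ‖z.1‖ ∧ ‖(radialExt N a b z).2‖ = ‖z.2‖ := by
  simp [radialExt, norm_smul]

theorem continuousOn_radialExt {T : Type*} [TopologicalSpace T] (N : 𝕊)
    {a b : T × (𝕊 × 𝕊) → 𝕊} (ha : Continuous a) (hb : Continuous b) {K : Set (E × E)}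
    (hK : ∀ z ∈ K, z.1 ≠ 0 ∧ z.2 ≠ 0) :
    ContinuousOn (fun w : T × (E × E) =>
      radialExt N (fun y => a (w.1, y)) (fun y => b (w.1, y)) w.2) (univ ×ˢ K) := by
  have h1 : ContinuousOn (fun w : T × (E × E) => toSphere N w.2.1) (univ ×ˢ K) :=
    (continuousOn_toSphere N).comp (by fun_prop) fun w hw => (hK _ hw.2).1
  have h2 : ContinuousOn (fun w : T × (E × E) => toSphere N w.2.2) (univ ×ˢ K) :=
    (continuousOn_toSphere N).comp (by fun_prop) fun w hw => (hK _ hw.2).2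
  have h3 : ContinuousOn (fun w : T × (E × E) => (w.1, toSphere N w.2.1, toSphere N w.2.2))
      (univ ×ˢ K) := continuousOn_fst.prodMk (h1.prodMk h2)
  refine ContinuousOn.prodMk (ContinuousOn.smul (by fun_prop) ?_)
    (ContinuousOn.smul (by fun_prop) ?_)
  · exact (continuous_subtype_val.comp ha).comp_continuousOn h3
  · exact (continuous_subtype_val.comp hb).comp_continuousOn h3

theorem continuousOn_radialExt' (N : 𝕊) {a b : 𝕊 × 𝕊 → 𝕊} (ha : Continuous a) (hb : Continuous b)
    {K : Set (E × E)} (hK : ∀ z ∈ K, z.1 ≠ 0 ∧ z.2 ≠ 0) : ContinuousOn (radialExt N a b) K :=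
  (continuousOn_radialExt (T := Unit) N (ha.comp continuous_snd) (hb.comp continuous_snd)
    hK).comp (f := fun z => ((), z)) (by fun_prop) fun _ hz => ⟨trivial, hz⟩

/-- The linear map that exchanges the factors of `E × E` on the orthogonal complement of `N` and
is `-1` on the multiples of `N`. -/
noncomputable def twistedSwap (N : E) : E × E →ₗ[ℝ] E × E :=
  (LinearMap.snd ℝ E E).prod (LinearMap.fst ℝ E E) -
    ((innerₗ E N).comp (LinearMap.fst ℝ E E + LinearMap.snd ℝ E E)).smulRight (N, N)

theorem twistedSwap_apply (N : E) (z : E × E) :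
    twistedSwap N z = (z.2 - inner ℝ N (z.1 + z.2) • N, z.1 - inner ℝ N (z.1 + z.2) • N) := by
  simp [twistedSwap]

theorem det_twistedSwap [FiniteDimensional ℝ E] {n : ℕ} (hE : Module.finrank ℝ E = n + 1)
    {N : E} (hN : ‖N‖ = 1) : LinearMap.det (twistedSwap N) = (-1) ^ n := by
  let e : (E × E) ≃ₗ[ℝ] (E × E) :=
    LinearEquiv.ofLinearMap
      ((LinearMap.fst ℝ E E + LinearMap.snd ℝ E E).prod (LinearMap.fst ℝ E E - LinearMap.snd ℝ E E))
      ((1 / 2 : ℝ) • (LinearMap.fst ℝ E E + LinearMap.snd ℝ E E).prod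
        (LinearMap.fst ℝ E E - LinearMap.snd ℝ E E))
      (by ext <;> simp [← two_smul ℝ, smul_smul]) (by ext <;> simp [← two_smul ℝ, smul_smul])
  have hconj : (e : E × E →ₗ[ℝ] E × E) ∘ₗ twistedSwap N =
      ((-1 : ℝ) • LinearMap.prodMap (ℝ ∙ N).reflection.toLinearEquiv.toLinearMap
        LinearMap.id) ∘ₗ e := by
    refine LinearMap.ext fun z => ?_
    have : e z = (z.1 + z.2, z.1 - z.2) := rfl
    simp only [LinearMap.comp_apply, LinearEquiv.coe_coe, twistedSwap_apply, this,
      LinearMap.smul_apply, LinearMap.prodMap_apply, LinearMap.id_apply]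
    have h2 : ∀ w, e w = (w.1 + w.2, w.1 - w.2) := fun _ => rfl
    rw [h2]
    simp only [LinearIsometryEquiv.coe_toLinearEquiv, Submodule.reflection_singleton_apply]
    ext <;> simp [hN]
    module
  have h1 := LinearMap.det_conj (twistedSwap N) e
  rw [← LinearMap.comp_assoc, hconj, LinearMap.comp_assoc] at h1
  simp only [LinearEquiv.comp_symm, LinearMap.comp_id] at h1
  rw [← h1, LinearMap.det_smul, LinearMap.det_prodMap, LinearMap.det_id, mul_one,
    Submodule.det_reflection]
  have : Fact (Module.finrank ℝ E = n + 1) := ⟨hE⟩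
  rw [Submodule.finrank_orthogonal_span_singleton (n := n) (by rintro rfl; simp at hN)]
  simp [hE, ← two_mul]

end SphereProduct

section HasDegLine

variable {V : Type*} [NormedAddCommGroup V] [NormedSpace ℝ V] [FiniteDimensional ℝ V]
  [MeasurableSpace V] [BorelSpace V] {μ : Measure V} [μ.IsAddHaarMeasure]

theorem HasDeg.line {K : Set V} {χ : V → ℝ} {p : V} {h₀ h₁ : V → V} {d : ℝ}
    (hK : IsCompact K) (hχ : ContDiff ℝ ∞ χ) (hχK : tsupport χ ⊆ K)
    (hc₀ : ContinuousOn h₀ K) (hc₁ : ContinuousOn h₁ K)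
    (hp : ∀ t ∈ Icc (0 : ℝ) 1, ∀ x ∈ tsupport χ, x ∈ tsupport (fderiv ℝ χ) →
      (1 - t) • h₀ x + t • h₁ x ≠ p)
    (h : HasDeg μ K χ p h₀ d) : HasDeg μ K χ p h₁ d := by
  have := HasDeg.homotopy (μ := μ) (p := p) (d := d) hK hχ hχK
    (H := fun w : I × V => (1 - (w.1 : ℝ)) • h₀ w.2 + (w.1 : ℝ) • h₁ w.2)
    (((by fun_prop : ContinuousOn (fun w : I × V => 1 - (w.1 : ℝ)) _).smul
      (hc₀.comp continuousOn_snd fun w hw => hw.2)).add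
      ((by fun_prop : ContinuousOn (fun w : I × V => (w.1 : ℝ)) _).smul
      (hc₁.comp continuousOn_snd fun w hw => hw.2)))
    (fun t x hx => hp t t.2 x (tsupport_fderiv_subset ℝ hx) hx) (by simpa using h)
  simpa using this

omit [FiniteDimensional ℝ V] [MeasurableSpace V] [BorelSpace V] in
theorem notMem_tsupport_fderiv_of_eventually {χ : V → ℝ} {c : ℝ} {x : V}
    (h : ∀ᶠ y in 𝓝 x, χ y = c) : x ∉ tsupport (fderiv ℝ χ) := by
  rw [notMem_tsupport_iff_eventuallyEq]
  filter_upwards [h.eventually_nhds] with y hy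
  have : χ =ᶠ[𝓝 y] fun _ => c := hy
  rw [this.fderiv_eq]
  simp

end HasDegLine

section SphereDegree

variable {E : Type*} [NormedAddCommGroup E] [InnerProductSpace ℝ E] [FiniteDimensional ℝ E]

local notation "𝕊" => Metric.sphere (0 : E) 1

/-- A product of two spherical shells around the unit sphere. -/
def shellProd (E : Type*) [NormedAddCommGroup E] : Set (E × E) :=
  {x | ‖x‖ ∈ Icc (1 / 2 : ℝ) 2} ×ˢ {x | ‖x‖ ∈ Icc (1 / 2 : ℝ) 2}

theorem isCompact_shellProd : IsCompact (shellProd E) := by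
  have : IsCompact {x : E | ‖x‖ ∈ Icc (1 / 2 : ℝ) 2} := by
    refine (isCompact_closedBall (0 : E) 2).of_isClosed_subset
      (isClosed_Icc.preimage continuous_norm) fun x hx => ?_
    simpa using hx.2
  exact this.prod this

omit [InnerProductSpace ℝ E] [FiniteDimensional ℝ E] in
theorem ne_zero_of_mem_shellProd {z : E × E} (hz : z ∈ shellProd E) : z.1 ≠ 0 ∧ z.2 ≠ 0 := by
  have h1 : 1 / 2 ≤ ‖z.1‖ := hz.1.1
  have h2 : 1 / 2 ≤ ‖z.2‖ := hz.2.1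
  exact ⟨norm_pos_iff.1 (by linarith), norm_pos_iff.1 (by linarith)⟩

/-- A smooth cutoff function equal to `1` near the product of the unit spheres. -/
structure IsShellCutoff (χ : E × E → ℝ) : Prop where
  smooth : ContDiff ℝ ∞ χ
  tsupport_subset : tsupport χ ⊆ shellProd E
  eventually_eq_one : ∀ z : E × E, ‖z.1‖ = 1 → ‖z.2‖ = 1 → ∀ᶠ y in 𝓝 z, χ y = 1

theorem exists_isShellCutoff : ∃ χ : E × E → ℝ, IsShellCutoff χ := by
  have hs : IsClosed {z : E × E | ‖z.1‖ = 1 ∧ ‖z.2‖ = 1} :=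
    (isClosed_eq (by fun_prop) continuous_const).inter (isClosed_eq (by fun_prop) continuous_const)
  have hopen : IsOpen {z : E × E | ‖z.1‖ ∈ Ioo (1 / 2 : ℝ) 2 ∧ ‖z.2‖ ∈ Ioo (1 / 2 : ℝ) 2} :=
    (isOpen_Ioo.preimage (by fun_prop : Continuous fun z : E × E => ‖z.1‖)).inter
      (isOpen_Ioo.preimage (by fun_prop : Continuous fun z : E × E => ‖z.2‖))
  obtain ⟨f, hf1, hf0, -⟩ := exists_contMDiffMap_one_nhds_of_subset_interior
    (modelWithCornersSelf ℝ (E × E)) (n := ⊤) hs (t := shellProd E) (fun z hz => by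
      refine interior_maximal ?_ hopen ⟨?_, ?_⟩
      · exact fun y hy => ⟨Ioo_subset_Icc_self hy.1, Ioo_subset_Icc_self hy.2⟩
      · norm_num [hz.1]
      · norm_num [hz.2])
  refine ⟨f, f.contMDiff.contDiff, ?_, fun z h1 h2 => ?_⟩
  · refine closure_minimal (fun z hz => ?_) isCompact_shellProd.isClosed
    by_contra h
    exact hz (hf0 z h)
  · exact Filter.eventually_of_mem (mem_nhdsSet_iff_forall.1 hf1 z ⟨h1, h2⟩) fun _ h => h

variable [MeasurableSpace E] [BorelSpace E] {μ : Measure (E × E)} [μ.IsAddHaarMeasure]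
  {χ : E × E → ℝ} {N : Metric.sphere (0 : E) 1} {d : ℝ}

theorem HasDeg.radialExt_homotopy (hχ : IsShellCutoff χ) {a b : I × (𝕊 × 𝕊) → 𝕊}
    (ha : Continuous a) (hb : Continuous b)
    (h : HasDeg μ (shellProd E) χ ((N : E), -(N : E))
      (radialExt N (fun y => a (0, y)) (fun y => b (0, y))) d) :
    HasDeg μ (shellProd E) χ ((N : E), -(N : E))
      (radialExt N (fun y => a (1, y)) (fun y => b (1, y))) d := by
  refine HasDeg.homotopy isCompact_shellProd hχ.smooth hχ.tsupport_subset
    (continuousOn_radialExt N ha hb fun z => ne_zero_of_mem_shellProd) (fun t z hz heq => ?_) h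
  have h1 := norm_radialExt N (fun y => a (t, y)) (fun y => b (t, y)) z
  rw [heq] at h1
  simp only [norm_neg, norm_eq_of_mem_sphere] at h1
  exact notMem_tsupport_fderiv_of_eventually (hχ.eventually_eq_one z h1.1.symm h1.2.symm) hz

omit [BorelSpace E] [μ.IsAddHaarMeasure] in
theorem hasDeg_radialExt_diag (hχ : IsShellCutoff χ) {a : 𝕊 × 𝕊 → 𝕊} (ha : Continuous a) :
    HasDeg μ (shellProd E) χ ((N : E), -(N : E)) (radialExt N a a) 0 := by
  refine hasDeg_zero isCompact_shellProd hχ.tsupport_subset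
    (continuousOn_radialExt' N ha ha fun z => ne_zero_of_mem_shellProd) fun z _ heq => ?_
  have h1 := norm_radialExt N a a z
  rw [heq] at h1
  simp only [norm_neg, norm_eq_of_mem_sphere] at h1
  simp only [radialExt, ← h1.1, ← h1.2, one_smul, Prod.mk.injEq] at heq
  exact ne_neg_of_mem_unit_sphere ℝ N (Subtype.ext (heq.1.symm.trans heq.2))

theorem hasDeg_radialExt_id (hχ : IsShellCutoff χ) :
    HasDeg μ (shellProd E) χ ((N : E), -(N : E)) (radialExt N Prod.fst Prod.snd) 1 := by
  have : radialExt N Prod.fst Prod.snd = ContinuousLinearMap.id ℝ (E × E) := by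
    ext z <;> simp [radialExt, norm_smul_toSphere]
  rw [this]
  exact hasDeg_linear isCompact_shellProd hχ.smooth hχ.tsupport_subset _
    (by simp [ContinuousLinearMap.det]) rfl (hχ.eventually_eq_one _ (by simp) (by simp))

omit [FiniteDimensional ℝ E] [MeasurableSpace E] [BorelSpace E] in
theorem eq_inner_smul_of_smul_sub_eq {N Y : E} {c α β : ℝ} (hc : 0 < c)
    (h : c • (Y - inner ℝ N Y • N) + β • N = α • N) (hN : ‖N‖ = 1) : Y = inner ℝ N Y • N := by
  have h1 : c • (Y - inner ℝ N Y • N) = (α - β) • N := by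
    rw [sub_smul, ← h]; abel
  have h2 : inner ℝ N (c • (Y - inner ℝ N Y • N)) = (0 : ℝ) := by
    simp [inner_smul_right, inner_sub_right, hN]
  rw [h1] at h2
  simp only [inner_smul_right, real_inner_self_eq_norm_sq, hN, one_pow, mul_one] at h2
  rw [h2, zero_smul, smul_eq_zero] at h1
  exact sub_eq_zero.1 (h1.resolve_left hc.ne')

theorem abs_eq_one_of_line {x y t : ℝ} (hx : x ≠ 0) (hy : y ≠ 0)
    (h1 : t * (|x| / |y|) * y - (1 - t) * x = 1)
    (h2 : t * (|y| / |x|) * x - (1 - t) * y = -1) : |x| = 1 ∧ |y| = 1 := by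
  rcases lt_or_gt_of_ne hx with hx | hx <;> rcases lt_or_gt_of_ne hy with hy | hy
  · rw [abs_of_neg hx, abs_of_neg hy] at *
    field_simp at h1 h2
    exfalso; nlinarith
  · rw [abs_of_neg hx, abs_of_pos hy] at *
    field_simp at h1 h2
    constructor <;> linarith
  · rw [abs_of_pos hx, abs_of_neg hy] at *
    field_simp at h1 h2
    constructor <;> linarith
  · rw [abs_of_pos hx, abs_of_pos hy] at *
    field_simp at h1 h2
    exfalso; nlinarith

theorem hasDeg_radialExt_swap (hχ : IsShellCutoff χ) {n : ℕ}
    (hE : Module.finrank ℝ E = n + 1) (hn : Even n) :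
    HasDeg μ (shellProd E) χ ((N : E), -(N : E)) (radialExt N Prod.snd Prod.fst) 1 := by
  have hN : ‖(N : E)‖ = 1 := norm_eq_of_mem_sphere N
  have hL := hasDeg_linear (μ := μ) (p := ((N : E), -(N : E))) (q := (-(N : E), (N : E)))
    isCompact_shellProd hχ.smooth hχ.tsupport_subset
    (LinearMap.toContinuousLinearMap (twistedSwap (N : E)))
    (by
      have := det_twistedSwap hE hN
      rw [hn.neg_one_pow] at this
      exact this)
    (by simp [twistedSwap_apply]) (hχ.eventually_eq_one _ (by simp) (by simp))
  refine hL.line isCompact_shellProd hχ.smooth hχ.tsupport_subset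
    (ContinuousLinearMap.continuous _).continuousOn
    (continuousOn_radialExt' N continuous_snd continuous_fst fun z => ne_zero_of_mem_shellProd)
    fun t ht z hzχ hz heq => ?_
  obtain ⟨X, Y⟩ := z
  obtain ⟨hX, hY⟩ : X ≠ 0 ∧ Y ≠ 0 := ne_zero_of_mem_shellProd (hχ.tsupport_subset hzχ)
  have hX' := norm_pos_iff.2 hX
  have hY' := norm_pos_iff.2 hY
  have hsX : (toSphere N X : E) = ‖X‖⁻¹ • X := by
    rw [eq_inv_smul_iff₀ hX'.ne', norm_smul_toSphere]
  have hsY : (toSphere N Y : E) = ‖Y‖⁻¹ • Y := by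
    rw [eq_inv_smul_iff₀ hY'.ne', norm_smul_toSphere]
  simp only [LinearMap.coe_toContinuousLinearMap', twistedSwap_apply, radialExt, hsX, hsY,
    Prod.ext_iff, Prod.smul_fst, Prod.smul_snd, Prod.fst_add, Prod.snd_add] at heq
  obtain ⟨e1, e2⟩ := heq
  have hc1 : 0 < t * (‖X‖ / ‖Y‖) + (1 - t) := by
    rcases ht.1.eq_or_lt with rfl | h
    · simp
    · have := ht.2; have := div_pos hX' hY'; nlinarith [mul_pos h this]
  have hc2 : 0 < t * (‖Y‖ / ‖X‖) + (1 - t) := by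
    rcases ht.1.eq_or_lt with rfl | h
    · simp
    · have := ht.2; have := div_pos hY' hX'; nlinarith [mul_pos h this]
  set x : ℝ := inner ℝ (N : E) X with hx
  set y : ℝ := inner ℝ (N : E) Y with hy
  rw [inner_add_right, ← hx, ← hy] at e1 e2
  have e1' : (t * (‖X‖ / ‖Y‖) + (1 - t)) • (Y - y • (N : E)) +
      (t * (‖X‖ / ‖Y‖) * y - (1 - t) * x) • (N : E) = (1 : ℝ) • (N : E) := by
    rw [one_smul]; refine Eq.trans ?_ e1; module
  have e2' : (t * (‖Y‖ / ‖X‖) + (1 - t)) • (X - x • (N : E)) +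
      (t * (‖Y‖ / ‖X‖) * x - (1 - t) * y) • (N : E) = (-1 : ℝ) • (N : E) := by
    rw [neg_one_smul]; refine Eq.trans ?_ e2; module
  have hYN : Y = y • (N : E) := eq_inner_smul_of_smul_sub_eq hc1 e1' hN
  have hXN : X = x • (N : E) := eq_inner_smul_of_smul_sub_eq hc2 e2' hN
  have hXx : ‖X‖ = |x| := by rw [hXN, norm_smul, hN, mul_one, Real.norm_eq_abs]
  have hYy : ‖Y‖ = |y| := by rw [hYN, norm_smul, hN, mul_one, Real.norm_eq_abs]
  rw [sub_eq_zero.2 hYN, smul_zero, zero_add] at e1'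
  rw [sub_eq_zero.2 hXN, smul_zero, zero_add] at e2'
  have hN0 : (N : E) ≠ 0 := ne_zero_of_mem_unit_sphere N
  have f1 := smul_left_injective ℝ hN0 e1'
  have f2 := smul_left_injective ℝ hN0 e2'
  rw [hXx, hYy] at f1 f2
  obtain ⟨g1, g2⟩ := abs_eq_one_of_line (abs_ne_zero.1 (hXx ▸ hX'.ne'))
    (abs_ne_zero.1 (hYy ▸ hY'.ne')) f1 f2
  exact notMem_tsupport_fderiv_of_eventually
    (hχ.eventually_eq_one (X, Y) (hXx.trans g1) (hYy.trans g2)) hz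


end SphereDegree

section Split

variable {E : Type*} [NormedAddCommGroup E] [InnerProductSpace ℝ E] [FiniteDimensional ℝ E]
  [MeasurableSpace E] [BorelSpace E] {μ : Measure (E × E)} [μ.IsAddHaarMeasure]
  {χ : E × E → ℝ} {N : Metric.sphere (0 : E) 1}

local notation "𝕊" => Metric.sphere (0 : E) 1

omit [FiniteDimensional ℝ E] [MeasurableSpace E] [BorelSpace E] in
theorem coe_toSphere_eq_of_smul_eq {M : 𝕊} {r : ℝ} {u : 𝕊} (hr : 0 ≤ r)
    (h : r • (u : E) = M) : r = 1 ∧ u = M := by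
  have h1 : r = 1 := by
    have := congrArg norm h
    simpa [norm_smul, abs_of_nonneg hr] using this
  refine ⟨h1, Subtype.ext ?_⟩
  rw [← h, h1, one_smul]

/-- Additivity of the degree, split along the sign of the height of the second factor: if at each
point one of `e₀`, `e₁` is the second projection, the degrees of `(e₀, y)` and `(y, e₁)` add up to
the degree of `(e₀, e₁)`. -/
theorem false_of_hasDeg_split (hχ : IsShellCutoff χ) {e₀ e₁ : 𝕊 × 𝕊 → 𝕊}
    (he₀ : Continuous e₀) (he₁ : Continuous e₁) (he : ∀ z, e₀ z = z.2 ∨ e₁ z = z.2)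
    (h : HasDeg μ (shellProd E) χ ((N : E), -(N : E)) (radialExt N e₀ e₁) 0)
    (h₀ : HasDeg μ (shellProd E) χ ((N : E), -(N : E)) (radialExt N e₀ Prod.snd) 1)
    (h₁ : HasDeg μ (shellProd E) χ ((N : E), -(N : E)) (radialExt N Prod.snd e₁) 1) : False := by
  have hN : ‖(N : E)‖ = 1 := norm_eq_of_mem_sphere N
  have hK := isCompact_shellProd (E := E)
  let θ : E × E → ℝ := fun z => Real.smoothTransition (inner ℝ (N : E) z.2 + 1 / 2)
  have hθ : ContDiff ℝ ∞ θ := Real.smoothTransition.contDiff.comp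
    (((innerSL ℝ (N : E)).contDiff.comp contDiff_snd).add contDiff_const)
  have hinner : Continuous fun z : E × E => inner ℝ (N : E) z.2 := by fun_prop
  let χ₁ : E × E → ℝ := fun z => χ z * θ z
  let χ₂ : E × E → ℝ := fun z => χ z - χ₁ z
  have hχ₂' : χ₂ = fun z => χ z * (1 - θ z) := by ext z; simp only [χ₂, χ₁]; ring
  have hs₁ : ContDiff ℝ ∞ χ₁ := hχ.smooth.mul hθ
  have hs₂ : ContDiff ℝ ∞ χ₂ := hχ.smooth.sub hs₁
  have ht₁ : tsupport χ₁ ⊆ tsupport χ := tsupport_mul_subset_left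
  have ht₂ : tsupport χ₂ ⊆ tsupport χ := by rw [hχ₂']; exact tsupport_mul_subset_left
  have hK₁ := ht₁.trans hχ.tsupport_subset
  have hK₂ := ht₂.trans hχ.tsupport_subset
  have hge : ∀ z ∈ tsupport χ₁, -(1 / 2) ≤ inner ℝ (N : E) z.2 := by
    refine closure_minimal (t := {z : E × E | -(1 / 2) ≤ inner ℝ (N : E) z.2}) (fun z hz => ?_)
      (isClosed_le continuous_const hinner)
    by_contra hlt
    have hlt : inner ℝ (N : E) z.2 < -(1 / 2) := not_le.1 hlt
    exact hz (by simp only [χ₁, θ]; rw [Real.smoothTransition.zero_of_nonpos (by linarith), mul_zero])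
  have hle : ∀ z ∈ tsupport χ₂, inner ℝ (N : E) z.2 ≤ 1 / 2 := by
    refine closure_minimal (t := {z : E × E | inner ℝ (N : E) z.2 ≤ 1 / 2}) (fun z hz => ?_)
      (isClosed_le hinner continuous_const)
    by_contra hlt
    have hlt : 1 / 2 < inner ℝ (N : E) z.2 := not_le.1 hlt
    exact hz (by
      rw [hχ₂']; simp only [θ]
      rw [Real.smoothTransition.one_of_one_le (by linarith), sub_self, mul_zero])
  have hcont : ∀ {a b : 𝕊 × 𝕊 → 𝕊}, Continuous a → Continuous b →
      ContinuousOn (radialExt N a b) (shellProd E) := fun ha hb =>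
    continuousOn_radialExt' N ha hb fun z => ne_zero_of_mem_shellProd
  have g₁ : HasDeg μ (shellProd E) χ₁ ((N : E), -(N : E)) (radialExt N Prod.snd e₁) 1 := by
    have hz : HasDeg μ (shellProd E) χ₂ ((N : E), -(N : E)) (radialExt N Prod.snd e₁) 0 := by
      refine hasDeg_zero hK hK₂ (hcont continuous_snd he₁) fun z hz heq => ?_
      obtain ⟨e1, e2⟩ := Prod.ext_iff.1 heq
      have hY : ‖z.2‖ = 1 := by
        rw [← (norm_radialExt N Prod.snd e₁ z).2, e2, norm_neg, hN]
      have h2 := (coe_toSphere_eq_of_smul_eq (norm_nonneg z.1) e1).2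
      have h3 : z.2 = N := by
        rw [← h2, toSphere_of_norm_eq_one N hY]
      have := hle z hz
      rw [h3, real_inner_self_eq_norm_sq, hN] at this
      norm_num at this
    have := h₁.sub hK hχ.smooth hχ.tsupport_subset hs₂ hK₂ hz
    simpa [χ₂] using this
  have g₂ : HasDeg μ (shellProd E) χ₂ ((N : E), -(N : E)) (radialExt N e₀ Prod.snd) 1 := by
    have hz : HasDeg μ (shellProd E) χ₁ ((N : E), -(N : E)) (radialExt N e₀ Prod.snd) 0 := by
      refine hasDeg_zero hK hK₁ (hcont he₀ continuous_snd) fun z hz heq => ?_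
      obtain ⟨e1, e2⟩ := Prod.ext_iff.1 heq
      have h3 : z.2 = -N := (norm_smul_toSphere N z.2).symm.trans e2
      have := hge z hz
      rw [h3, inner_neg_right, real_inner_self_eq_norm_sq, hN] at this
      norm_num at this
    simpa [χ₂] using h₀.sub hK hχ.smooth hχ.tsupport_subset hs₁ hK₁ hz
  have k₁ : HasDeg μ (shellProd E) χ₁ ((N : E), -(N : E)) (radialExt N e₀ e₁) 1 := by
    refine g₁.line hK hs₁ hK₁ (hcont continuous_snd he₁) (hcont he₀ he₁)
      fun t ht z hzχ hz heq => ?_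
    obtain ⟨q1, q2⟩ := Prod.ext_iff.1 heq
    simp only [Prod.fst_add, Prod.snd_add, Prod.smul_fst, Prod.smul_snd, radialExt] at q1 q2
    rw [← add_smul, sub_add_cancel, one_smul] at q2
    obtain ⟨hY, hv⟩ := coe_toSphere_eq_of_smul_eq (M := -N) (norm_nonneg z.2) q2
    rcases he (toSphere N z.1, toSphere N z.2) with hcase | hcase
    · rw [hcase, ← add_smul, sub_add_cancel, one_smul] at q1
      obtain ⟨hX, hu⟩ := coe_toSphere_eq_of_smul_eq (norm_nonneg z.1) q1
      have hYN : z.2 = N := by rw [← toSphere_of_norm_eq_one N hY, hu]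
      refine notMem_tsupport_fderiv_of_eventually (c := 1) ?_ hz
      have hlt : (1 / 2 : ℝ) < inner ℝ (N : E) z.2 := by
        rw [hYN, real_inner_self_eq_norm_sq, hN]; norm_num
      filter_upwards [hχ.eventually_eq_one z hX hY, hinner.continuousAt.eventually_const_lt hlt]
        with y hy1 hy2
      simp only [χ₁, θ]
      rw [hy1, Real.smoothTransition.one_of_one_le (by linarith), mul_one]
    · have hYN : z.2 = -N := by
        rw [← toSphere_of_norm_eq_one N hY,
          show toSphere N z.2 = -N from hcase.symm.trans hv]
        rfl
      have := hge z hzχ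
      rw [hYN, inner_neg_right, real_inner_self_eq_norm_sq, hN] at this
      norm_num at this
  have k₂ : HasDeg μ (shellProd E) χ₂ ((N : E), -(N : E)) (radialExt N e₀ e₁) 1 := by
    refine g₂.line hK hs₂ hK₂ (hcont he₀ continuous_snd) (hcont he₀ he₁)
      fun t ht z hzχ hz heq => ?_
    obtain ⟨q1, q2⟩ := Prod.ext_iff.1 heq
    simp only [Prod.fst_add, Prod.snd_add, Prod.smul_fst, Prod.smul_snd, radialExt] at q1 q2
    rw [← add_smul, sub_add_cancel, one_smul] at q1
    obtain ⟨hX, hu⟩ := coe_toSphere_eq_of_smul_eq (norm_nonneg z.1) q1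
    rcases he (toSphere N z.1, toSphere N z.2) with hcase | hcase
    · have hYN : z.2 = ‖z.2‖ • (N : E) := by
        rw [← hu, hcase, norm_smul_toSphere]
      have h1 := hle z hzχ
      rw [hYN, inner_smul_right, real_inner_self_eq_norm_sq, hN, one_pow, mul_one] at h1
      have h2 := norm_add_le ((1 - t) • ‖z.2‖ • (toSphere N z.2 : E))
        (t • ‖z.2‖ • (e₁ (toSphere N z.1, toSphere N z.2) : E))
      rw [q2] at h2
      simp only [norm_neg, norm_eq_of_mem_sphere, norm_smul, Real.norm_eq_abs, abs_norm,
        abs_of_nonneg ht.1, abs_of_nonneg (sub_nonneg.2 ht.2), mul_one] at h2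
      linarith
    · rw [hcase, ← add_smul, sub_add_cancel, one_smul] at q2
      obtain ⟨hY, hv⟩ := coe_toSphere_eq_of_smul_eq (M := -N) (norm_nonneg z.2) q2
      have hYN : z.2 = -N := (norm_smul_toSphere N z.2).symm.trans q2
      refine notMem_tsupport_fderiv_of_eventually (c := 1) ?_ hz
      have hlt : inner ℝ (N : E) z.2 < -(1 / 2 : ℝ) := by
        rw [hYN, inner_neg_right, real_inner_self_eq_norm_sq, hN]; norm_num
      filter_upwards [hχ.eventually_eq_one z hX hY, hinner.continuousAt.eventually_lt_const hlt]
        with y hy1 hy2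
      rw [hχ₂']
      simp only [θ]
      rw [hy1, Real.smoothTransition.zero_of_nonpos (by linarith), sub_zero, mul_one]
  have := k₂.unique hK (hcont he₀ he₁) (h.sub hK hχ.smooth hχ.tsupport_subset hs₁ hK₁ k₁)
  norm_num at this

end Split

section Sections

variable {X : Type*} [TopologicalSpace X]

/-- A section of the path fibration over `U`, damped by a cutoff function `τ`, is a homotopy
defined on the whole of `X × X`. -/
theorem exists_homotopy_of_section {U : Set (X × X)} (hU : IsOpen U) (s : C(U, C(I, X)))
    (hs : ∀ p : U, (s p) 0 = (p : X × X).1 ∧ (s p) 1 = (p : X × X).2)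
    (τ : C(X × X, ℝ)) (hτ : tsupport τ ⊆ U) (hτI : ∀ z, τ z ∈ Icc (0 : ℝ) 1) :
    ∃ g : I × (X × X) → X, Continuous g ∧ (∀ z, g (0, z) = z.1) ∧
      ∀ z, τ z = 1 → g (1, z) = z.2 := by
  classical
  let c : X × X → I := fun z => ⟨τ z, hτI z⟩
  have hc : Continuous c := τ.continuous.subtype_mk _
  let g : I × (X × X) → X := fun w => if h : w.2 ∈ U then s ⟨w.2, h⟩ (w.1 * c w.2) else w.2.1
  have hin : ∀ w : I × (X × X), ∀ h : w.2 ∈ U, g w = s ⟨w.2, h⟩ (w.1 * c w.2) :=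
    fun w h => dif_pos h
  have hout : ∀ w : I × (X × X), τ w.2 = 0 → g w = w.2.1 := by
    intro w hw
    by_cases h : w.2 ∈ U
    · have : c w.2 = 0 := Subtype.ext hw
      rw [hin w h, this, mul_zero, (hs ⟨w.2, h⟩).1]
    · exact dif_neg h
  refine ⟨g, ?_, fun z => ?_, fun z hz => ?_⟩
  · rw [continuous_iff_continuousAt]
    intro w
    by_cases h : w.2 ∈ U
    · have hopen : IsOpen {w : I × (X × X) | w.2 ∈ U} := hU.preimage continuous_snd
      refine ContinuousOn.continuousAt (s := {w : I × (X × X) | w.2 ∈ U}) ?_ (hopen.mem_nhds h)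
      rw [continuousOn_iff_continuous_domRestrict]
      have : {w : I × (X × X) | w.2 ∈ U}.domRestrict g =
          fun w => s ⟨w.1.2, w.2⟩ (w.1.1 * c w.1.2) := by
        ext w; exact hin w.1 w.2
      rw [this]
      have h1 : Continuous fun w : {w : I × (X × X) | w.2 ∈ U} => s ⟨w.1.2, w.2⟩ :=
        s.continuous.comp (by fun_prop)
      exact ContinuousEval.continuous_eval.comp (h1.prodMk (by fun_prop))
    · have hev : ∀ᶠ y in 𝓝 w, g y = y.2.1 := by
        have h0 : ∀ᶠ z in 𝓝 w.2, τ z = 0 :=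
          notMem_tsupport_iff_eventuallyEq.1 fun hmem => h (hτ hmem)
        filter_upwards [continuous_snd.continuousAt.eventually h0] with y hy using hout y hy
      exact (continuous_fst.comp continuous_snd).continuousAt.congr
        (hev.mono fun y hy => hy.symm)
  · by_cases h : z ∈ U
    · rw [hin (0, z) h, zero_mul, (hs ⟨z, h⟩).1]
    · exact dif_neg h
  · have h : z ∈ U := hτ (subset_tsupport _ (by simp [hz]))
    have hc1 : c z = 1 := Subtype.ext hz
    rw [hin (1, z) h, one_mul, hc1, (hs ⟨z, h⟩).2]

theorem TCCover.exists_homotopies [CompactSpace X] [T2Space X] {n : ℕ} (h : TCCover X n) :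
    ∃ g : Fin (n + 1) → I × (X × X) → X, (∀ i, Continuous (g i)) ∧
      (∀ i z, g i (0, z) = z.1) ∧ ∀ z, ∃ i, g i (1, z) = z.2 := by
  obtain ⟨U, hU, hcov, hs⟩ := h
  choose s hs using hs
  obtain ⟨C, hC, hCc, hCU⟩ := exists_iUnion_eq_closed_subset hU (fun _ => Set.toFinite _) hcov
  choose τ hτ1 hτ2 hτ3 using fun i => exists_tsupport_one_of_isOpen_isClosed (hU i)
    (isClosed_closure.isCompact) (hCc i) (hCU i)
  choose g hg1 hg2 hg3 using fun i =>
    exists_homotopy_of_section (hU i) (s i) (hs i) (τ i) (hτ1 i) (hτ3 i)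
  refine ⟨g, hg1, hg2, fun z => ?_⟩
  obtain ⟨i, hi⟩ := mem_iUnion.1 (hC ▸ mem_univ z : z ∈ ⋃ i, C i)
  exact ⟨i, hg3 i z (hτ2 i hi)⟩

end Sections

section LowerBound

variable {E : Type*} [NormedAddCommGroup E] [InnerProductSpace ℝ E] [FiniteDimensional ℝ E]

theorem not_tcCover_sphere_zero (N : Metric.sphere (0 : E) 1) :
    ¬ TCCover (Metric.sphere (0 : E) 1) 0 := by
  borelize E
  intro h
  obtain ⟨g, hg, hg0, hg1⟩ := h.exists_homotopies
  obtain ⟨χ, hχ⟩ := exists_isShellCutoff (E := E)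
  have h1 : ∀ z, g 0 (1, z) = z.2 := fun z => by
    obtain ⟨i, hi⟩ := hg1 z
    obtain rfl : i = 0 := Fin.fin_one_eq_zero i
    exact hi
  have key := HasDeg.radialExt_homotopy (N := N) (μ := Measure.addHaar) (d := 1) hχ (hg 0)
    (b := fun w => w.2.2) (by fun_prop)
    (by simpa only [hg0] using hasDeg_radialExt_id hχ)
  simp only [h1] at key
  have := key.unique isCompact_shellProd
    (continuousOn_radialExt' N continuous_snd continuous_snd fun z => ne_zero_of_mem_shellProd)
    (hasDeg_radialExt_diag hχ continuous_snd)
  exact one_ne_zero this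

theorem not_tcCover_sphere_one {n : ℕ} (hE : Module.finrank ℝ E = n + 1) (hn : Even n)
    (N : Metric.sphere (0 : E) 1) : ¬ TCCover (Metric.sphere (0 : E) 1) 1 := by
  borelize E
  intro h
  obtain ⟨g, hg, hg0, hg1⟩ := h.exists_homotopies
  obtain ⟨χ, hχ⟩ := exists_isShellCutoff (E := E)
  have hend : ∀ i, Continuous fun z => g i (1, z) := fun i => (hg i).comp (by fun_prop)
  refine false_of_hasDeg_split (N := N) (μ := Measure.addHaar) hχ (hend 0) (hend 1)
    (fun z => ?_) ?_ ?_ ?_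
  · obtain ⟨i, hi⟩ := hg1 z
    fin_cases i
    · exact Or.inl hi
    · exact Or.inr hi
  · refine HasDeg.radialExt_homotopy hχ (hg 0) (hg 1) ?_
    simpa only [hg0] using hasDeg_radialExt_diag hχ continuous_fst
  · refine HasDeg.radialExt_homotopy hχ (hg 0) (b := fun w => w.2.2) (by fun_prop) ?_
    simpa only [hg0] using hasDeg_radialExt_id hχ
  · refine HasDeg.radialExt_homotopy hχ (a := fun w => w.2.2) (by fun_prop) (hg 1) ?_
    simpa only [hg0] using hasDeg_radialExt_swap hχ hE hn

end LowerBound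

section UpperBound

theorem exists_section_of_homotopic {X : Type*} [TopologicalSpace X] {U : Set (X × X)}
    (h : Homotopic (⟨fun p : U => p.1.1, by fun_prop⟩ : C(U, X)) ⟨fun p : U => p.1.2, by fun_prop⟩) :
    ∃ s : C(U, C(I, X)), ∀ p : U, (s p) 0 = (p : X × X).1 ∧ (s p) 1 = (p : X × X).2 := by
  obtain ⟨F⟩ := h
  exact ⟨(F.toContinuousMap.comp ContinuousMap.prodSwap).curry,
    fun p => ⟨F.apply_zero p, F.apply_one p⟩⟩

variable {E : Type*} [NormedAddCommGroup E] [InnerProductSpace ℝ E]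

local notation "𝕊" => Metric.sphere (0 : E) 1

theorem homotopic_of_ne_neg {Y : Type*} [TopologicalSpace Y] (N : 𝕊) {a b : C(Y, 𝕊)}
    (h : ∀ y, a y ≠ -b y) : Homotopic a b := by
  have hne : ∀ w : I × Y, (1 - (w.1 : ℝ)) • (a w.2 : E) + (w.1 : ℝ) • (b w.2 : E) ≠ 0 := by
    intro w hw
    have h1 := eq_neg_of_add_eq_zero_left hw
    have h2 := congrArg norm h1
    simp only [norm_neg, norm_smul, norm_eq_of_mem_sphere, mul_one, Real.norm_eq_abs,
      abs_of_nonneg w.1.2.1, abs_of_nonneg (sub_nonneg.2 w.1.2.2)] at h2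
    have h3 : (w.1 : ℝ) ≠ 0 := by intro h0; rw [h0] at h2; norm_num at h2
    rw [h2, ← smul_neg] at h1
    exact h w.2 (Subtype.ext (smul_right_injective E h3 h1))
  refine ⟨⟨⟨fun w => toSphere N ((1 - (w.1 : ℝ)) • (a w.2 : E) + (w.1 : ℝ) • (b w.2 : E)), ?_⟩,
    fun y => ?_, fun y => ?_⟩⟩
  · exact (continuousOn_toSphere N).comp_continuous (by fun_prop) hne
  · exact Subtype.ext (by simp [toSphere_of_norm_eq_one])
  · exact Subtype.ext (by simp [toSphere_of_norm_eq_one])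

theorem homotopic_fst_snd_of_ne_neg (N : 𝕊) {U : Set (𝕊 × 𝕊)} (hU : ∀ z ∈ U, z.1 ≠ -z.2) :
    Homotopic (⟨fun p : U => p.1.1, by fun_prop⟩ : C(U, 𝕊)) ⟨fun p : U => p.1.2, by fun_prop⟩ :=
  homotopic_of_ne_neg N fun p => hU p.1 p.2

theorem tcCover_sphere_one_of_tangent (v : C(𝕊, 𝕊)) (hv : ∀ x : 𝕊, inner ℝ (x : E) (v x) = 0)
    (N : 𝕊) : TCCover 𝕊 1 := by
  refine ⟨![{z | z.1 ≠ -z.2}, {z | z.1 ≠ z.2}], ?_, ?_, ?_⟩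
  · intro i
    fin_cases i
    · exact isOpen_ne_fun continuous_fst continuous_snd.neg
    · exact isOpen_ne_fun continuous_fst continuous_snd
  · refine eq_univ_of_forall fun z => mem_iUnion.2 ?_
    by_cases h : z.1 = -z.2
    · refine ⟨1, fun h' : z.1 = z.2 => ne_neg_of_mem_unit_sphere ℝ z.2 (h'.symm.trans h)⟩
    · exact ⟨0, h⟩
  · intro i
    refine exists_section_of_homotopic ?_
    fin_cases i
    · exact homotopic_fst_snd_of_ne_neg N fun z hz => hz
    · change Homotopic (⟨fun p : {z : 𝕊 × 𝕊 | z.1 ≠ z.2} => p.1.1, _⟩ : C(_, 𝕊))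
        ⟨fun p : {z : 𝕊 × 𝕊 | z.1 ≠ z.2} => p.1.2, _⟩
      have hinner : ∀ x : 𝕊, inner ℝ (x : E) x = 1 := fun x => by
        simp
      refine (homotopic_of_ne_neg N (b := ⟨fun p => v p.1.1, by fun_prop⟩) fun p hp => ?_).trans
        ((homotopic_of_ne_neg N (b := ⟨fun p => -p.1.1, by fun_prop⟩) fun p hp => ?_).trans
        (homotopic_of_ne_neg N fun p hp => p.2 (neg_injective hp)))
      · have := hv p.1.1
        have h2 : ((p.1.1 : 𝕊) : E) = -(v p.1.1 : E) := congrArg Subtype.val hp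
        have h3 := hinner p.1.1
        nth_rewrite 2 [h2] at h3
        rw [inner_neg_right, this] at h3
        norm_num at h3
      · have := hv p.1.1
        have h2 : v p.1.1 = p.1.1 := by simpa using hp
        rw [h2, hinner] at this
        norm_num at this

theorem tcCover_sphere_two (N M : 𝕊) (h₁ : M ≠ N) (h₂ : M ≠ -N) : TCCover 𝕊 2 := by
  refine ⟨![{z | z.1 ≠ -z.2}, {z | z.1 ≠ z.2} ∩ ({z | z.1 ≠ N} ∩ {z | z.1 ≠ -N}),
    {z | z.1 ≠ -M} ∩ {z | z.2 ≠ -M}], ?_, ?_, ?_⟩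
  · intro i
    fin_cases i
    · exact isOpen_ne_fun continuous_fst continuous_snd.neg
    · exact (isOpen_ne_fun continuous_fst continuous_snd).inter
        ((isOpen_ne_fun continuous_fst continuous_const).inter
          (isOpen_ne_fun continuous_fst continuous_const))
    · exact (isOpen_ne_fun continuous_fst continuous_const).inter
        (isOpen_ne_fun continuous_snd continuous_const)
  · refine eq_univ_of_forall fun z => mem_iUnion.2 ?_
    by_cases h : z.1 = -z.2
    · have hne : z.1 ≠ z.2 := fun h' => ne_neg_of_mem_unit_sphere ℝ z.2 (h'.symm.trans h)
      have hz : z.2 = -z.1 := by rw [h, neg_neg]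
      by_cases hN : z.1 = N
      · refine ⟨2, fun h' : z.1 = -M => h₂ ?_, fun h' : z.2 = -M => h₁ ?_⟩
        · rw [← hN, h', neg_neg]
        · rw [← hN]; exact (neg_injective (hz.symm.trans h')).symm
      by_cases hN' : z.1 = -N
      · refine ⟨2, fun h' : z.1 = -M => h₁ ?_, fun h' : z.2 = -M => h₂ ?_⟩
        · exact neg_injective (h'.symm.trans hN')
        · rw [← hN']; exact (neg_injective (hz.symm.trans h')).symm
      · exact ⟨1, hne, hN, hN'⟩
    · exact ⟨0, h⟩
  · intro i
    refine exists_section_of_homotopic ?_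
    fin_cases i
    · exact homotopic_fst_snd_of_ne_neg N fun z hz => hz
    · exact (homotopic_of_ne_neg N (b := .const _ N) fun p hp => p.2.2.2 hp).trans
        ((homotopic_of_ne_neg N (b := ⟨fun p => -p.1.1, by fun_prop⟩)
          fun p hp => p.2.2.1 (hp.trans (neg_neg _)).symm).trans
        (homotopic_of_ne_neg N fun p hp => p.2.1 (neg_injective hp)))
    · exact (homotopic_of_ne_neg N (b := .const _ M) fun p hp => p.2.1 hp).trans
        (homotopic_of_ne_neg N (a := .const _ M) fun p hp => p.2.2 (neg_eq_iff_eq_neg.2 hp).symm)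

end UpperBound

section OddSphere

theorem exists_tangent_of_odd {n : ℕ} (hn : Odd n) :
    ∃ v : C(Sph n, Sph n), ∀ x : Sph n, inner ℝ (x : EuclideanSpace ℝ (Fin (n + 1))) (v x) = 0 := by
  obtain ⟨m, hm⟩ := hn.add_one
  let ε : Fin (n + 1) ≃ Fin m ⊕ Fin m := (finCongr hm).trans finSumFinEquiv.symm
  let e : EuclideanSpace ℝ (Fin (n + 1)) ≃ₗᵢ[ℝ] EuclideanSpace ℝ (Fin m ⊕ Fin m) :=
    LinearIsometryEquiv.piLpCongrLeft 2 ℝ ℝ ε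
  let J : EuclideanSpace ℝ (Fin m ⊕ Fin m) → EuclideanSpace ℝ (Fin m ⊕ Fin m) := fun y =>
    WithLp.toLp 2 (Sum.elim (fun i => -y (Sum.inr i)) fun i => y (Sum.inl i))
  have hJ : Continuous J := by
    refine (PiLp.continuous_toLp 2 _).comp (continuous_pi fun i => ?_)
    rcases i with i | i <;> simp only [Sum.elim_inl, Sum.elim_inr] <;> fun_prop
  have hJn : ∀ y, ‖J y‖ = ‖y‖ := by
    intro y
    simp only [EuclideanSpace.norm_eq, Fintype.sum_sum_type, J, Sum.elim_inl, Sum.elim_inr,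
      norm_neg]
    rw [add_comm]
  have hJi : ∀ y, inner ℝ y (J y) = 0 := by
    intro y
    simp only [PiLp.inner_apply, Fintype.sum_sum_type, J, Sum.elim_inl, Sum.elim_inr,
      inner_neg_right, Finset.sum_neg_distrib]
    rw [neg_add_eq_zero]
    exact Finset.sum_congr rfl fun i _ => real_inner_comm _ _
  refine ⟨⟨fun x => ⟨e.symm (J (e x)), by simp [hJn]⟩, by fun_prop⟩, fun x => ?_⟩
  change inner ℝ (x : EuclideanSpace ℝ (Fin (n + 1))) (e.symm (J (e x))) = 0
  rw [← e.inner_map_map, e.apply_symm_apply, hJi]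

theorem exists_sphere_ne_ne_neg {n : ℕ} (hn : 1 ≤ n) : ∃ N M : Sph n, M ≠ N ∧ M ≠ -N := by
  have h0 : Fin.last n ≠ 0 := by rw [Ne, Fin.ext_iff]; simp; omega
  let s : Fin (n + 1) → Sph n := fun i => ⟨EuclideanSpace.single i 1, by simp⟩
  refine ⟨s 0, s (Fin.last n), fun h => ?_, fun h => ?_⟩
  · have := congrArg (fun x : Sph n => x.1 0) h
    simp [s, h0] at this
  · have := congrArg (fun x : Sph n => x.1 0) h
    simp [s, h0] at this

theorem TCCover.mono {X : Type*} [TopologicalSpace X] {m n : ℕ} (hmn : m ≤ n) (h : TCCover X m) :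
    TCCover X n := by
  obtain ⟨U, hU, hcov, hs⟩ := h
  have hlt : ∀ i : Fin (n + 1), min i.1 m < m + 1 := fun i => by omega
  refine ⟨fun i => U ⟨min i.1 m, hlt i⟩, fun i => hU _, ?_, fun i => hs _⟩
  refine eq_univ_of_forall fun z => ?_
  obtain ⟨i, hi⟩ := mem_iUnion.1 (hcov ▸ mem_univ z : z ∈ ⋃ i, U i)
  refine mem_iUnion.2 ⟨⟨i, by omega⟩, ?_⟩
  have : (⟨min i.1 m, by omega⟩ : Fin (m + 1)) = i := Fin.ext (by simp; omega)
  simpa only [this] using hi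

theorem sInf_image_natCast_eq {P : ℕ → Prop} {m : ℕ} (hm : P m) (hlt : ∀ k < m, ¬ P k) :
    sInf ((fun k : ℕ => (k : ℕ∞)) '' {k | P k}) = m := by
  refine le_antisymm (sInf_le ⟨m, hm, rfl⟩) (le_sInf ?_)
  rintro _ ⟨k, hk, rfl⟩
  exact Nat.cast_le.2 (not_lt.1 fun h => hlt k h hk)

theorem topComplexity_sphere_odd {n : ℕ} (hn : Odd n) : TopComplexity (Sph n) = 1 := by
  obtain ⟨N, -⟩ := exists_sphere_ne_ne_neg hn.pos
  obtain ⟨v, hv⟩ := exists_tangent_of_odd hn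
  refine (sInf_image_natCast_eq (m := 1) (tcCover_sphere_one_of_tangent v hv N)
    fun k hk => ?_).trans Nat.cast_one
  obtain rfl : k = 0 := by omega
  exact not_tcCover_sphere_zero N

theorem topComplexity_sphere_even {n : ℕ} (h1 : 1 ≤ n) (hn : Even n) :
    TopComplexity (Sph n) = 2 := by
  obtain ⟨N, M, hM, hM'⟩ := exists_sphere_ne_ne_neg h1
  refine (sInf_image_natCast_eq (m := 2) (tcCover_sphere_two N M hM hM')
    fun k hk h => ?_).trans Nat.cast_two
  exact not_tcCover_sphere_one (by simp) hn N (h.mono (by omega))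

end OddSphere

section CupLength

variable {R : Type*} [Ring R] [Algebra ℚ R]

theorem exists_smul_add_smul_of_map_eq_zero {f : R →ₐ[ℚ] DualNumber ℚ} {a b : R}
    (hspan : ∀ x : R, ∃ c α β γ : ℚ, x = c • 1 + α • a + β • b + γ • (a * b))
    (ha : f a = DualNumber.eps) (hb : f b = DualNumber.eps) {x : R} (hx : f x = 0) :
    ∃ α γ : ℚ, x = α • (a - b) + γ • (a * b) := by
  obtain ⟨c, α, β, γ, rfl⟩ := hspan x
  simp only [map_add, map_smul, map_one, map_mul, ha, hb, DualNumber.eps_mul_eps, smul_zero,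
    add_zero] at hx
  have h0 := congrArg TrivSqZeroExt.fst hx
  have h1 := congrArg TrivSqZeroExt.snd hx
  simp at h0 h1
  have hβ : β = -α := by linarith
  subst h0 hβ
  exact ⟨α, γ, by module⟩

/-- The span of `1, a, b, ab` is closed under multiplication when `a² = b² = 0` and `ba = ±ab`. -/
theorem exists_mul_eq_of_sq_eq_zero {a b : R} {s : ℚ} (ha : a * a = 0) (hb : b * b = 0)
    (hba : b * a = s • (a * b)) {x y : R}
    (hx : ∃ c α β γ : ℚ, x = c • 1 + α • a + β • b + γ • (a * b))
    (hy : ∃ c α β γ : ℚ, y = c • 1 + α • a + β • b + γ • (a * b)) :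
    ∃ c α β γ : ℚ, x * y = c • 1 + α • a + β • b + γ • (a * b) := by
  obtain ⟨c, α, β, γ, rfl⟩ := hx
  obtain ⟨c', α', β', γ', rfl⟩ := hy
  have h1 : a * (a * b) = 0 := by rw [← mul_assoc, ha, zero_mul]
  have h2 : a * b * b = 0 := by rw [mul_assoc, hb, mul_zero]
  have h3 : b * (a * b) = 0 := by rw [← mul_assoc, hba, smul_mul_assoc, h2, smul_zero]
  have h4 : a * b * a = 0 := by rw [mul_assoc, hba, mul_smul_comm, h1, smul_zero]
  have h5 : a * b * (a * b) = 0 := by rw [mul_assoc, h3, mul_zero]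
  refine ⟨c * c', c * α' + α * c', c * β' + β * c', c * γ' + γ * c' + α * β' + s * β * α', ?_⟩
  simp only [mul_add, add_mul, smul_mul_smul_comm, one_mul, mul_one, ha, hb, hba, h1, h2, h3, h4,
    h5, smul_zero]
  module

end CupLength

section CupOdd

theorem ι_snd_mul_ι_fst :
    (ExteriorAlgebra.ι ℚ ((0, 1) : ℚ × ℚ)) * ExteriorAlgebra.ι ℚ ((1, 0) : ℚ × ℚ) =
      (-1 : ℚ) • (ExteriorAlgebra.ι ℚ ((1, 0) : ℚ × ℚ) * ExteriorAlgebra.ι ℚ ((0, 1) : ℚ × ℚ)) := by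
  rw [neg_one_smul, eq_neg_iff_add_eq_zero]
  exact ExteriorAlgebra.ι_add_mul_swap _ _

theorem exteriorAlgebra_prod_span (x : ExteriorAlgebra ℚ (ℚ × ℚ)) :
    ∃ c α β γ : ℚ, x = c • 1 + α • ExteriorAlgebra.ι ℚ ((1, 0) : ℚ × ℚ) +
      β • ExteriorAlgebra.ι ℚ ((0, 1) : ℚ × ℚ) +
      γ • (ExteriorAlgebra.ι ℚ ((1, 0) : ℚ × ℚ) * ExteriorAlgebra.ι ℚ ((0, 1) : ℚ × ℚ)) := by
  induction x using ExteriorAlgebra.induction with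
  | algebraMap r => exact ⟨r, 0, 0, 0, by simp [Algebra.algebraMap_eq_smul_one]⟩
  | ι v =>
    refine ⟨0, v.1, v.2, 0, ?_⟩
    rw [← map_smul, ← map_smul, zero_smul, zero_smul, zero_add, add_zero, ← map_add]
    simp
  | mul x y hx hy =>
    exact exists_mul_eq_of_sq_eq_zero (ExteriorAlgebra.ι_sq_zero _) (ExteriorAlgebra.ι_sq_zero _)
      ι_snd_mul_ι_fst hx hy
  | add x y hx hy =>
    obtain ⟨c, α, β, γ, rfl⟩ := hx
    obtain ⟨c', α', β', γ', rfl⟩ := hy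
    exact ⟨c + c', α + α', β + β', γ + γ', by module⟩

theorem cupOdd_ι (v : ℚ × ℚ) :
    cupOdd (ExteriorAlgebra.ι ℚ v) = (v.1 + v.2) • (DualNumber.eps : DualNumber ℚ) := by
  simp [cupOdd]

theorem nilIndex_ker_cupOdd : nilIndex {x | cupOdd x = 0} = 1 := by
  refine sInf_image_natCast_eq (m := 1) ?_ ?_
  · intro l hl hK
    obtain ⟨x, y, rfl⟩ := List.length_eq_two.1 hl
    have key : ∀ z ∈ [x, y], _ := fun z hz => exists_smul_add_smul_of_map_eq_zero
      exteriorAlgebra_prod_span (by simp [cupOdd_ι]) (by simp [cupOdd_ι]) (hK z hz)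
    obtain ⟨α, γ, rfl⟩ := key x (by simp)
    obtain ⟨α', γ', rfl⟩ := key y (by simp)
    have hba := ι_snd_mul_ι_fst
    have ha := ExteriorAlgebra.ι_sq_zero (R := ℚ) ((1, 0) : ℚ × ℚ)
    have hb := ExteriorAlgebra.ι_sq_zero (R := ℚ) ((0, 1) : ℚ × ℚ)
    generalize ExteriorAlgebra.ι ℚ ((1, 0) : ℚ × ℚ) = a at *
    generalize ExteriorAlgebra.ι ℚ ((0, 1) : ℚ × ℚ) = b at *
    have h1 : a * (a * b) = 0 := by rw [← mul_assoc, ha, zero_mul]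
    have h2 : a * b * b = 0 := by rw [mul_assoc, hb, mul_zero]
    have h3 : b * (a * b) = 0 := by rw [← mul_assoc, hba, smul_mul_assoc, h2, smul_zero]
    have h4 : a * b * a = 0 := by rw [mul_assoc, hba, mul_smul_comm, h1, smul_zero]
    have h5 : a * b * (a * b) = 0 := by rw [mul_assoc, h3, mul_zero]
    simp only [List.prod_cons, List.prod_nil, mul_one, mul_add, add_mul, mul_sub, sub_mul,
      smul_mul_smul_comm, ha, hb, hba, h1, h2, h3, h4, h5, smul_zero]
    module
  · intro k hk h
    obtain rfl : k = 0 := by lia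
    have h0 := h [ExteriorAlgebra.ι ℚ ((1, -1) : ℚ × ℚ)] rfl (by simp [cupOdd_ι])
    rw [List.prod_singleton, ExteriorAlgebra.ι_eq_zero_iff] at h0
    simp at h0

end CupOdd

section CupEven

theorem dualNumber_tensor_span (x : DualNumber ℚ ⊗[ℚ] DualNumber ℚ) :
    ∃ c α β γ : ℚ, x = c • 1 + α • (DualNumber.eps ⊗ₜ[ℚ] 1) + β • (1 ⊗ₜ[ℚ] DualNumber.eps) +
      γ • ((DualNumber.eps ⊗ₜ[ℚ] 1) * (1 ⊗ₜ[ℚ] DualNumber.eps)) := by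
  have hd : ∀ u : DualNumber ℚ, u = u.fst • 1 + u.snd • DualNumber.eps := fun u => by
    ext <;> simp
  induction x using TensorProduct.induction_on with
  | zero => exact ⟨0, 0, 0, 0, by simp⟩
  | tmul u v =>
    refine ⟨u.fst * v.fst, u.snd * v.fst, u.fst * v.snd, u.snd * v.snd, ?_⟩
    conv_lhs => rw [hd u, hd v]
    simp only [Algebra.TensorProduct.one_def, Algebra.TensorProduct.tmul_mul_tmul, one_mul, mul_one,
      add_tmul, tmul_add, smul_tmul_smul]
    module
  | add x y hx hy =>
    obtain ⟨c, α, β, γ, rfl⟩ := hx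
    obtain ⟨c', α', β', γ', rfl⟩ := hy
    exact ⟨c + c', α + α', β + β', γ + γ', by module⟩

theorem eps_tmul_eps_ne_zero :
    (DualNumber.eps : DualNumber ℚ) ⊗ₜ[ℚ] (DualNumber.eps : DualNumber ℚ) ≠ 0 := fun h => by
  have := congrArg (LinearMap.mul' ℚ ℚ ∘ₗ TensorProduct.map (TrivSqZeroExt.sndHom ℚ ℚ)
    (TrivSqZeroExt.sndHom ℚ ℚ)) h
  simp at this

theorem nilIndex_ker_cupEven : nilIndex {x | cupEven x = 0} = 2 := by
  refine sInf_image_natCast_eq (m := 2) ?_ ?_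
  · intro l hl hK
    obtain ⟨x, y, z, rfl⟩ := List.length_eq_three.1 hl
    have key : ∀ w ∈ [x, y, z], _ := fun w hw => exists_smul_add_smul_of_map_eq_zero
      dualNumber_tensor_span (by simp [cupEven]) (by simp [cupEven]) (hK w hw)
    obtain ⟨α, γ, rfl⟩ := key x (by simp)
    obtain ⟨α', γ', rfl⟩ := key y (by simp)
    obtain ⟨α'', γ'', rfl⟩ := key z (by simp)
    have ha : ((DualNumber.eps : DualNumber ℚ) ⊗ₜ[ℚ] (1 : DualNumber ℚ)) ^ 2 = 0 := by
      simp [sq]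
    have hb : ((1 : DualNumber ℚ) ⊗ₜ[ℚ] (DualNumber.eps : DualNumber ℚ)) ^ 2 = 0 := by
      simp [sq]
    generalize (DualNumber.eps : DualNumber ℚ) ⊗ₜ[ℚ] (1 : DualNumber ℚ) = a at *
    generalize (1 : DualNumber ℚ) ⊗ₜ[ℚ] (DualNumber.eps : DualNumber ℚ) = b at *
    simp only [List.prod_cons, List.prod_nil, mul_one, Algebra.smul_def]
    grind
  · intro k hk h
    have hmem : cupEven ((DualNumber.eps : DualNumber ℚ) ⊗ₜ[ℚ] (1 : DualNumber ℚ) -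
        (1 : DualNumber ℚ) ⊗ₜ[ℚ] (DualNumber.eps : DualNumber ℚ)) = 0 := by
      simp [cupEven]
    have h0 := h (List.replicate (k + 1) _) (List.length_replicate ..)
      (fun x hx => (List.eq_of_mem_replicate hx).symm ▸ hmem)
    rw [List.prod_replicate] at h0
    have h2 := pow_eq_zero_of_le (show k + 1 ≤ 2 by lia) h0
    refine eps_tmul_eps_ne_zero ?_
    have h3 : (-2 : ℚ) • ((DualNumber.eps : DualNumber ℚ) ⊗ₜ[ℚ] (DualNumber.eps : DualNumber ℚ))
        = 0 := by
      rw [← h2, sq]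
      simp only [sub_mul, mul_sub, Algebra.TensorProduct.tmul_mul_tmul, one_mul, mul_one,
        DualNumber.eps_mul_eps, zero_tmul, tmul_zero]
      module
    simpa using h3

end CupEven

end

/-- Farber: `TC(Sⁿ) = 1` for `n` odd and `TC(Sⁿ) = 2` for `n` even, and in both
cases `TC(Sⁿ)` equals the zero-divisor cup-length `nil ker ∪_{Sⁿ}` of `Sⁿ` with
rational coefficients. -/
theorem tc_sphere (n : ℕ) (hn : 1 ≤ n) :
    (Odd n → TopComplexity (Sph n) = 1 ∧
      nilIndex {x | cupOdd x = 0} = TopComplexity (Sph n)) ∧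
    (Even n → TopComplexity (Sph n) = 2 ∧
      nilIndex {x | cupEven x = 0} = TopComplexity (Sph n)) := by
  exact ⟨fun h => ⟨topComplexity_sphere_odd h,
      nilIndex_ker_cupOdd.trans (topComplexity_sphere_odd h).symm⟩,
    fun h => ⟨topComplexity_sphere_even hn h,
      nilIndex_ker_cupEven.trans (topComplexity_sphere_even hn h).symm⟩⟩
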